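/- For 1 < p < N define Λ_p(Ω) := lim_{q → (Np/(N−p))⁻} λ_q(Ω) (this limit exists since q ↦ λ_q(Ω)|Ω|^{p/q} is non-increasing on [1, Np/(N−p))). Then, as p → N from the left, Λ_p(Ω)/(N−p)^{p−1} converges to N ω_N/(N−1)^{N−1}. -/

import Mathlib

open MeasureTheory Filter Topology Metric

noncomputable def lambdaQ {N : ℕ} (Ω : Set (EuclideanSpace ℝ (Fin N))) (p q : ℝ) : ℝ :=
  sInf { c : ℝ | ∃ u : EuclideanSpace ℝ (Fin N) → ℝ,
    ContDiff ℝ (⊤ : ℕ∞) u ∧ HasCompactSupport u ∧ tsupport u ⊆ Ω ∧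
    (∫ x in Ω, |u x| ^ q) ^ (1 / q) = 1 ∧
    c = ∫ x in Ω, ‖gradient u x‖ ^ p }

open scoped ENNReal


theorem s9_polar {N : ℕ} (hN : 2 ≤ N) (G : EuclideanSpace ℝ (Fin N) → ℝ≥0∞) (hG : Measurable G) :
    ∫⁻ y, G y = ∫⁻ θ : sphere (0 : EuclideanSpace ℝ (Fin N)) 1,
      (∫⁻ t in Set.Ioi (0:ℝ), ENNReal.ofReal (t ^ (N - 1)) * G (t • (θ : EuclideanSpace ℝ (Fin N))))
        ∂((volume : Measure (EuclideanSpace ℝ (Fin N))).toSphere) := by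
  have : Nontrivial (EuclideanSpace ℝ (Fin N)) := by
    have : Nonempty (Fin N) := ⟨⟨0, by omega⟩⟩
    infer_instance
  have hmp := (volume : Measure (EuclideanSpace ℝ (Fin N))).measurePreserving_homeomorphUnitSphereProd
  have h1 : ∫⁻ y, G y = ∫⁻ y : ({(0:EuclideanSpace ℝ (Fin N))}ᶜ : Set _), G y
      ∂((volume : Measure (EuclideanSpace ℝ (Fin N))).comap (↑)) := by
    rw [lintegral_subtype_comap (measurableSet_singleton _).compl G, restrict_compl_singleton]
  have h2 := hmp.lintegral_comp_emb (Homeomorph.measurableEmbedding _)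
    (fun z : sphere (0 : EuclideanSpace ℝ (Fin N)) 1 × Set.Ioi (0:ℝ) => G ((z.2 : ℝ) • (z.1 : EuclideanSpace ℝ (Fin N))))
  have hmeas : Measurable (fun z : sphere (0 : EuclideanSpace ℝ (Fin N)) 1 × Set.Ioi (0:ℝ) => G ((z.2 : ℝ) • (z.1 : EuclideanSpace ℝ (Fin N)))) := by
    apply hG.comp
    fun_prop
  rw [h1]
  refine Eq.trans (Eq.trans ?_ h2) ?_
  · apply lintegral_congr
    intro y
    congr 1
    simp only [homeomorphUnitSphereProd_apply_snd_coe, homeomorphUnitSphereProd_apply_fst_coe]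
    rw [smul_smul, mul_inv_cancel₀, one_smul]
    exact norm_ne_zero_iff.2 y.2
  rw [lintegral_prod _ hmeas.aemeasurable]
  apply lintegral_congr
  intro θ
  rw [Measure.volumeIoiPow]
  have hh : Measurable fun t : ℝ => G (t • (θ : EuclideanSpace ℝ (Fin N))) := by
    apply hG.comp
    fun_prop
  rw [lintegral_withDensity_eq_lintegral_mul _ (by fun_prop) (by exact hh.comp measurable_subtype_coe)]
  rw [← lintegral_subtype_comap measurableSet_Ioi]
  simp only [Pi.mul_apply, finrank_euclideanSpace_fin]
  try rfl

theorem s9_ray {N : ℕ} (u : EuclideanSpace ℝ (Fin N) → ℝ) (hu : ContDiff ℝ 1 u)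
    (hc : HasCompactSupport u) (x θ : EuclideanSpace ℝ (Fin N)) (hθ : ‖θ‖ = 1) :
    ‖u x‖ₑ ≤ ∫⁻ t in Set.Ioi (0:ℝ), ‖fderiv ℝ u (x + t • θ)‖ₑ := by
  have hd : ∀ t : ℝ, HasDerivAt (fun t : ℝ => u (x + t • θ)) (fderiv ℝ u (x + t • θ) θ) t := by
    intro t
    have h1 : HasDerivAt (fun t : ℝ => x + t • θ) θ t := by
      simpa using ((hasDerivAt_id t).smul_const θ).const_add x
    exact ((hu.differentiable (by norm_num)) (x + t • θ)).hasFDerivAt.comp_hasDerivAt t h1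
  have hcl : IsClosedEmbedding (fun t : ℝ => x + t • θ) := by
    have : Isometry (fun t : ℝ => x + t • θ) := by
      apply Isometry.of_dist_eq
      intro a b
      rw [dist_add_left, dist_eq_norm, ← sub_smul, norm_smul, hθ, mul_one, Real.dist_eq, Real.norm_eq_abs]
    exact this.isClosedEmbedding
  have hc1 : HasCompactSupport (fun t : ℝ => u (x + t • θ)) := hc.comp_isClosedEmbedding hcl
  have hc2 : HasCompactSupport (fun t : ℝ => fderiv ℝ u (x + t • θ)) :=
    (hc.fderiv ℝ).comp_isClosedEmbedding hcl
  have hcont : Continuous (fun t : ℝ => fderiv ℝ u (x + t • θ)) :=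
    (hu.continuous_fderiv (by norm_num)).comp (by fun_prop)
  have hcont' : Continuous (fun t : ℝ => fderiv ℝ u (x + t • θ) θ) := by fun_prop
  have hc3 : HasCompactSupport (fun t : ℝ => fderiv ℝ u (x + t • θ) θ) :=
    hc2.comp_left (g := fun L : EuclideanSpace ℝ (Fin N) →L[ℝ] ℝ => L θ) (by simp)
  have hint : Integrable (fun t : ℝ => fderiv ℝ u (x + t • θ) θ) := hcont'.integrable_of_hasCompactSupport hc3
  have hten : Tendsto (fun t : ℝ => u (x + t • θ)) atTop (𝓝 0) := by
    have := hc1.is_zero_at_infty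
    exact this.mono_left atTop_le_cocompact
  have key := integral_Ioi_of_hasDerivAt_of_tendsto' (a := 0) (fun t _ => hd t) hint.integrableOn hten
  simp only [zero_smul, add_zero, zero_sub] at key
  calc ‖u x‖ₑ = ‖∫ t in Set.Ioi (0:ℝ), fderiv ℝ u (x + t • θ) θ‖ₑ := by rw [key, enorm_neg]
    _ ≤ ∫⁻ t in Set.Ioi (0:ℝ), ‖fderiv ℝ u (x + t • θ) θ‖ₑ := enorm_integral_le_lintegral_enorm _
    _ ≤ _ := by
      apply lintegral_mono
      intro t
      dsimp only
      rw [enorm_le_iff_norm_le]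
      simpa [hθ] using (fderiv ℝ u (x + t • θ)).le_opNorm θ

theorem s9_potential {N : ℕ} (hN : 2 ≤ N) (u : EuclideanSpace ℝ (Fin N) → ℝ) (hu : ContDiff ℝ 1 u)
    (hc : HasCompactSupport u) (x : EuclideanSpace ℝ (Fin N)) :
    (N * volume (ball (0 : EuclideanSpace ℝ (Fin N)) 1)) * ‖u x‖ₑ ≤
      ∫⁻ y, ENNReal.ofReal (‖y‖ ^ (1 - N : ℝ)) * ‖fderiv ℝ u (x + y)‖ₑ := by
  have hcont : Continuous (fun y => fderiv ℝ u (x + y)) :=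
    (hu.continuous_fderiv (by norm_num)).comp (by fun_prop)
  rw [s9_polar hN]
  · have hS := (volume : Measure (EuclideanSpace ℝ (Fin N))).toSphere_apply_univ
    rw [finrank_euclideanSpace_fin] at hS
    rw [← hS, mul_comm, ← lintegral_const]
    apply lintegral_mono
    intro θ
    have hθ : ‖(θ : EuclideanSpace ℝ (Fin N))‖ = 1 := by simp
    refine (s9_ray u hu hc x θ hθ).trans ?_
    apply setLIntegral_mono' measurableSet_Ioi
    intro t ht
    have ht' : 0 < t := ht
    rw [← mul_assoc, ← ENNReal.ofReal_mul (by positivity), norm_smul, hθ, mul_one, Real.norm_eq_abs,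
      abs_of_pos ht', ← Real.rpow_natCast, ← Real.rpow_add ht', Nat.cast_sub (by omega)]
    simp
  · fun_prop


noncomputable def s9M {N : ℕ} (F : EuclideanSpace ℝ (Fin N) → ℝ≥0∞) (x : EuclideanSpace ℝ (Fin N)) : ℝ≥0∞ :=
  ⨆ k : ℤ, (∫⁻ y in closedBall x ((2:ℝ) ^ k), F y) / volume (closedBall x ((2:ℝ) ^ k))

theorem s9_vol {N : ℕ} (x : EuclideanSpace ℝ (Fin N)) {r : ℝ} (hr : 0 ≤ r) :
    volume (closedBall x r) = ENNReal.ofReal (r ^ N) * volume (ball (0 : EuclideanSpace ℝ (Fin N)) 1) := by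
  rw [Measure.addHaar_closedBall _ _ hr, finrank_euclideanSpace_fin]

theorem s9_vol_ne {N : ℕ} (x : EuclideanSpace ℝ (Fin N)) (k : ℤ) :
    volume (closedBall x ((2:ℝ) ^ k)) ≠ 0 ∧ volume (closedBall x ((2:ℝ) ^ k)) ≠ ⊤ :=
  ⟨(measure_closedBall_pos _ _ (by positivity)).ne', measure_closedBall_lt_top.ne⟩

theorem s9_weak {N : ℕ} (hN : 2 ≤ N) (F : EuclideanSpace ℝ (Fin N) → ℝ≥0∞)
    (hI : ∫⁻ y, F y ≠ ⊤) (t : ℝ≥0∞) (ht : t ≠ 0) (ht' : t ≠ ⊤) :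
    volume {x | t < s9M F x} * t ≤ 5 ^ N * ∫⁻ y, F y := by
  set ω := volume (ball (0 : EuclideanSpace ℝ (Fin N)) 1) with hω
  have hω0 : ω ≠ 0 := (measure_ball_pos _ _ one_pos).ne'
  have hωt : ω ≠ ⊤ := measure_ball_lt_top.ne
  let T : Set (EuclideanSpace ℝ (Fin N) × ℤ) :=
    {a | t * volume (closedBall a.1 ((2:ℝ) ^ a.2)) < ∫⁻ y in closedBall a.1 ((2:ℝ) ^ a.2), F y}
  have hR : ∀ a ∈ T, (2:ℝ) ^ a.2 ≤ 1 + ((∫⁻ y, F y) / (t * ω)).toReal := by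
    intro a ha
    have h1 : t * volume (closedBall a.1 ((2:ℝ) ^ a.2)) ≤ ∫⁻ y, F y :=
      (le_of_lt ha).trans (setLIntegral_le_lintegral _ _)
    have hpos : (0:ℝ) < (2:ℝ) ^ a.2 := by positivity
    rw [s9_vol _ hpos.le] at h1
    have h2 : ENNReal.ofReal (((2:ℝ) ^ a.2) ^ N) ≤ (∫⁻ y, F y) / (t * ω) := by
      rw [ENNReal.le_div_iff_mul_le (Or.inl (mul_ne_zero ht hω0)) (Or.inl (ENNReal.mul_ne_top ht' hωt))]
      calc _ = _ := by ring
        _ ≤ _ := h1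
    have hfin : (∫⁻ y, F y) / (t * ω) ≠ ⊤ := ENNReal.div_ne_top hI (mul_ne_zero ht hω0)
    rw [ENNReal.ofReal_le_iff_le_toReal hfin] at h2
    rcases le_total ((2:ℝ) ^ a.2) 1 with h | h
    · have : 0 ≤ ((∫⁻ y, F y) / (t * ω)).toReal := ENNReal.toReal_nonneg
      linarith
    · have : (2:ℝ) ^ a.2 ≤ ((2:ℝ) ^ a.2) ^ N := le_self_pow₀ h (by omega)
      linarith
  obtain ⟨v, hvT, hdisj, hcov⟩ := Vitali.exists_disjoint_subfamily_covering_enlargement_closedBall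
    T (fun a => a.1) (fun a => (2:ℝ) ^ a.2) _ hR 5 (by norm_num)
  have hcount : v.Countable := by
    apply hdisj.countable_of_nonempty_interior
    intro a _
    exact ⟨a.1, ball_subset_interior_closedBall (mem_ball_self (by positivity))⟩
  have hsub : {x | t < s9M F x} ⊆ ⋃ a ∈ v, closedBall a.1 (5 * (2:ℝ) ^ a.2) := by
    intro x hx
    obtain ⟨k, hk⟩ := lt_iSup_iff.1 (show t < s9M F x from hx)
    have hk' : (x, k) ∈ T := by
      have := s9_vol_ne x k
      rw [ENNReal.lt_div_iff_mul_lt (Or.inl this.1) (Or.inl this.2)] at hk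
      exact hk
    obtain ⟨b, hb, hbs⟩ := hcov _ hk'
    refine Set.mem_biUnion hb (hbs (mem_closedBall_self (by positivity)))
  calc volume {x | t < s9M F x} * t ≤ (∑' a : v, volume (closedBall a.1.1 (5 * (2:ℝ) ^ a.1.2))) * t := by
        gcongr
        exact (measure_mono hsub).trans (measure_biUnion_le _ hcount _)
    _ = ∑' a : v, 5 ^ N * (t * volume (closedBall a.1.1 ((2:ℝ) ^ a.1.2))) := by
        rw [← ENNReal.tsum_mul_right]
        congr 1
        ext a
        rw [s9_vol _ (by positivity), s9_vol _ (by positivity), mul_pow, ENNReal.ofReal_mul (by positivity)]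
        rw [show ENNReal.ofReal (5 ^ N) = 5 ^ N by rw [ENNReal.ofReal_pow (by norm_num)]; norm_num]
        ring
    _ ≤ ∑' a : v, 5 ^ N * (∫⁻ y in closedBall a.1.1 ((2:ℝ) ^ a.1.2), F y) := by
        gcongr with a
        exact le_of_lt (hvT a.2)
    _ = 5 ^ N * ∫⁻ y in ⋃ a ∈ v, closedBall a.1 ((2:ℝ) ^ a.2), F y := by
        rw [ENNReal.tsum_mul_left, lintegral_biUnion hcount (fun _ _ => measurableSet_closedBall) hdisj]
    _ ≤ _ := by gcongr; exact Measure.restrict_le_self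

theorem s9M_measurable {N : ℕ} (F : EuclideanSpace ℝ (Fin N) → ℝ≥0∞) (hF : Measurable F) :
    Measurable (s9M F) := by
  unfold s9M
  apply Measurable.iSup
  intro k
  have h1 : ∀ x : EuclideanSpace ℝ (Fin N), ∫⁻ y in closedBall x ((2:ℝ) ^ k), F y =
      ∫⁻ y, {z : EuclideanSpace ℝ (Fin N) × EuclideanSpace ℝ (Fin N) | dist z.2 z.1 ≤ (2:ℝ)^k}.indicator (fun z => F z.2) (x, y) := by
    intro x
    rw [← lintegral_indicator measurableSet_closedBall]
    rfl
  have h2 : ∀ x : EuclideanSpace ℝ (Fin N), volume (closedBall x ((2:ℝ) ^ k)) =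
    volume (closedBall (0: EuclideanSpace ℝ (Fin N)) ((2:ℝ) ^ k)) := fun x => by
      rw [s9_vol _ (by positivity), s9_vol _ (by positivity)]
  simp_rw [h1, h2]
  apply Measurable.div_const
  apply Measurable.lintegral_prod_right
  apply Measurable.indicator (hF.comp measurable_snd)
  exact measurableSet_le (by fun_prop) (by fun_prop)

theorem s9M_le {N : ℕ} (F : EuclideanSpace ℝ (Fin N) → ℝ≥0∞) (K : ℝ≥0∞) (hK : ∀ x, F x ≤ K) (x) :
    s9M F x ≤ K := by
  apply iSup_le
  intro k
  have := s9_vol_ne x k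
  rw [ENNReal.div_le_iff this.1 this.2]
  calc _ ≤ ∫⁻ y in closedBall x ((2:ℝ) ^ k), K := lintegral_mono hK
    _ = _ := by simp

theorem s9M_add_le {N : ℕ} (F G : EuclideanSpace ℝ (Fin N) → ℝ≥0∞) (K : ℝ≥0∞)
    (h : ∀ x, F x ≤ G x + K) (hG : Measurable G) (x) :
    s9M F x ≤ s9M G x + K := by
  apply iSup_le
  intro k
  have hv := s9_vol_ne x k
  calc _ ≤ (∫⁻ y in closedBall x ((2:ℝ) ^ k), (G y + K)) / volume (closedBall x ((2:ℝ) ^ k)) := by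
        gcongr; apply h
    _ = (∫⁻ y in closedBall x ((2:ℝ) ^ k), G y) / volume (closedBall x ((2:ℝ) ^ k)) + K := by
        rw [lintegral_add_left hG, ENNReal.add_div]
        congr 1
        simp [ENNReal.mul_div_cancel_right hv.1 hv.2]
    _ ≤ _ := by
        gcongr
        exact le_iSup (fun k : ℤ => (∫⁻ y in closedBall x ((2:ℝ) ^ k), G y) / volume (closedBall x ((2:ℝ) ^ k))) k

theorem s9_inner (p a : ℝ) (hp : 1 < p) (ha : 0 ≤ a) :
    ∫⁻ t in Set.Ioi (0:ℝ), (Set.Iio (2 * a)).indicator (fun t => ENNReal.ofReal (t ^ (p - 2))) t =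
      ENNReal.ofReal ((2 * a) ^ (p - 1) / (p - 1)) := by
  rw [setLIntegral_indicator measurableSet_Iio, Set.inter_comm, Set.Ioi_inter_Iio, restrict_Ioo_eq_restrict_Ioc]
  have h0 : (0:ℝ) ≤ 2 * a := by linarith
  have hi := intervalIntegral.intervalIntegrable_rpow' (a := 0) (b := 2 * a) (r := p - 2) (by linarith)
  rw [← ofReal_integral_eq_lintegral_ofReal hi.1]
  · rw [← intervalIntegral.integral_of_le h0, integral_rpow (Or.inl (by linarith))]
    rw [show p - 2 + 1 = p - 1 by ring, Real.zero_rpow (by linarith), sub_zero]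
  · filter_upwards [ae_restrict_mem measurableSet_Ioc] with t ht
    exact Real.rpow_nonneg ht.1.le _

theorem s9_strong {N : ℕ} (hN : 2 ≤ N) (f : EuclideanSpace ℝ (Fin N) → ℝ) (hf : Measurable f)
    (h0 : ∀ x, 0 ≤ f x) (K : ℝ) (hK : ∀ x, f x ≤ K)
    (hI : ∫⁻ y, ENNReal.ofReal (f y) ≠ ⊤) (p : ℝ) (hp : 1 < p) :
    ∫⁻ x, (s9M (fun y => ENNReal.ofReal (f y)) x) ^ p ≤
      ENNReal.ofReal (p * 5 ^ N * 2 ^ p / (p - 1)) * ∫⁻ x, ENNReal.ofReal (f x) ^ p := by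
  set F : EuclideanSpace ℝ (Fin N) → ℝ≥0∞ := fun y => ENNReal.ofReal (f y) with hF
  have hFm : Measurable F := by fun_prop
  have hMm : Measurable (s9M F) := s9M_measurable F hFm
  have hMtop : ∀ x, s9M F x ≠ ⊤ := fun x =>
    ((s9M_le F (ENNReal.ofReal K) (fun x => ENNReal.ofReal_le_ofReal (hK x)) x).trans_lt ENNReal.ofReal_lt_top).ne
  have h1 : ∀ x, (s9M F x) ^ p = ENNReal.ofReal ((s9M F x).toReal ^ p) := by
    intro x
    rw [← ENNReal.ofReal_rpow_of_nonneg ENNReal.toReal_nonneg (by linarith), ENNReal.ofReal_toReal (hMtop x)]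
  simp_rw [h1]
  rw [lintegral_rpow_eq_lintegral_meas_lt_mul _ (Eventually.of_forall fun x => ENNReal.toReal_nonneg)
    hMm.ennreal_toReal.aemeasurable (by linarith)]
  have h2 : ∀ t ∈ Set.Ioi (0:ℝ), volume {a | t < (s9M F a).toReal} * ENNReal.ofReal (t ^ (p - 1)) ≤
      ∫⁻ x, (5 ^ N * 2) * ((Set.Iio (2 * f x)).indicator (fun t => ENNReal.ofReal (t ^ (p - 2))) t * F x) := by
    intro t ht
    have ht' : (0:ℝ) < t := ht
    set G : EuclideanSpace ℝ (Fin N) → ℝ≥0∞ := {y | t < 2 * f y}.indicator F with hG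
    have hmset : MeasurableSet {y | t < 2 * f y} := measurableSet_lt (by fun_prop) (by fun_prop)
    have hGm : Measurable G := hFm.indicator hmset
    have hGI : ∫⁻ y, G y ≠ ⊤ := by
      refine ne_top_of_le_ne_top hI (lintegral_mono ?_)
      exact Set.indicator_le_self _ _
    have hFG : ∀ x, F x ≤ G x + ENNReal.ofReal (t / 2) := by
      intro x
      by_cases h : t < 2 * f x
      · rw [hG, Set.indicator_of_mem (by exact h)]; exact le_self_add
      · rw [hG, Set.indicator_of_notMem (by exact h), zero_add]
        apply ENNReal.ofReal_le_ofReal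
        linarith
    have hsub : {a | t < (s9M F a).toReal} ⊆ {a | ENNReal.ofReal (t / 2) < s9M G a} := by
      intro x hx
      have hx' : ENNReal.ofReal t < s9M F x := (ENNReal.ofReal_lt_iff_lt_toReal ht'.le (hMtop x)).2 hx
      by_contra hcon
      have hcon' : s9M G x ≤ ENNReal.ofReal (t / 2) := not_lt.1 hcon
      have := s9M_add_le F G _ hFG hGm x
      have h3 : s9M F x ≤ ENNReal.ofReal t := by
        refine this.trans ((add_le_add_left hcon' _).trans ?_)
        rw [← ENNReal.ofReal_add (by positivity) (by positivity)]
        simp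
      exact absurd hx' (not_lt.2 h3)
    have hw := s9_weak hN G hGI (ENNReal.ofReal (t / 2)) (by simpa using ht') ENNReal.ofReal_ne_top
    have e1 : ENNReal.ofReal (t ^ (p - 1)) = ENNReal.ofReal (t/2) * (2 * ENNReal.ofReal (t ^ (p - 2))) := by
      rw [show (2:ℝ≥0∞) = ENNReal.ofReal 2 by norm_num, ← ENNReal.ofReal_mul (by norm_num), ← ENNReal.ofReal_mul (by positivity)]
      congr 1
      rw [show p - 1 = (p - 2) + 1 by ring, Real.rpow_add_one ht'.ne']
      ring
    calc _ ≤ volume {a | ENNReal.ofReal (t / 2) < s9M G a} * ENNReal.ofReal (t ^ (p - 1)) := by gcongr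
      _ = (volume {a | ENNReal.ofReal (t / 2) < s9M G a} * ENNReal.ofReal (t/2)) * (2 * ENNReal.ofReal (t ^ (p - 2))) := by
        rw [e1, mul_assoc]
      _ ≤ (5 ^ N * ∫⁻ y, G y) * (2 * ENNReal.ofReal (t ^ (p - 2))) := by gcongr
      _ = (5 ^ N * 2) * (ENNReal.ofReal (t ^ (p - 2)) * ∫⁻ y, G y) := by ring
      _ = _ := by
        rw [lintegral_const_mul' _ _ (by finiteness), ← lintegral_const_mul' _ _ (by finiteness)]
        congr 2
        ext x
        by_cases h : t < 2 * f x
        · rw [hG, Set.indicator_of_mem (by exact h), Set.indicator_of_mem (by exact h)]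
        · rw [hG, Set.indicator_of_notMem (by exact h), Set.indicator_of_notMem (by exact h)]; simp
  have hsw : ∫⁻ t in Set.Ioi (0:ℝ), ∫⁻ x, (5 ^ N * 2) * ((Set.Iio (2 * f x)).indicator (fun t => ENNReal.ofReal (t ^ (p - 2))) t * F x)
     = ∫⁻ x, (5 ^ N * 2) * (ENNReal.ofReal ((2 * f x) ^ (p - 1) / (p - 1)) * F x) := by
    rw [lintegral_lintegral_swap]
    · apply lintegral_congr
      intro x
      rw [lintegral_const_mul' _ _ (by finiteness), lintegral_mul_const' _ _ (by finiteness), s9_inner p (f x) hp (h0 x)]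
    · apply Measurable.aemeasurable
      have : (Function.uncurry fun t x => (5 ^ N * 2) * ((Set.Iio (2 * f x)).indicator (fun t => ENNReal.ofReal (t ^ (p - 2))) t * F x))
        = fun z : ℝ × EuclideanSpace ℝ (Fin N) => (5 ^ N * 2) * (({z : ℝ × EuclideanSpace ℝ (Fin N) | z.1 < 2 * f z.2}.indicator (fun z => ENNReal.ofReal (z.1 ^ (p - 2))) z) * F z.2) := by
        ext z; rfl
      rw [this]
      apply Measurable.const_mul
      apply Measurable.mul _ (hFm.comp measurable_snd)
      apply Measurable.indicator (by fun_prop)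
      exact measurableSet_lt (by fun_prop) (by fun_prop)
  calc _ ≤ ENNReal.ofReal p * ∫⁻ t in Set.Ioi (0:ℝ), ∫⁻ x, (5 ^ N * 2) * ((Set.Iio (2 * f x)).indicator (fun t => ENNReal.ofReal (t ^ (p - 2))) t * F x) := by
        exact mul_le_mul' le_rfl (setLIntegral_mono' measurableSet_Ioi h2)
    _ = ∫⁻ x, ENNReal.ofReal p * ((5 ^ N * 2) * (ENNReal.ofReal ((2 * f x) ^ (p - 1) / (p - 1)) * F x)) := by
        rw [hsw, ← lintegral_const_mul' _ _ (by finiteness)]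
    _ = ∫⁻ x, ENNReal.ofReal (p * 5 ^ N * 2 ^ p / (p - 1)) * ENNReal.ofReal (f x) ^ p := by
        apply lintegral_congr
        intro x
        have hp1 : 0 < p - 1 := by linarith
        rw [hF]
        dsimp only
        rw [ENNReal.ofReal_rpow_of_nonneg (h0 x) (by linarith)]
        rw [show (5 ^ N * 2 : ℝ≥0∞) = ENNReal.ofReal (5 ^ N * 2) by
          rw [ENNReal.ofReal_mul (by positivity), ENNReal.ofReal_pow (by norm_num)]; norm_num]
        have := h0 x
        rw [← ENNReal.ofReal_mul (by positivity), ← ENNReal.ofReal_mul (by positivity), ← ENNReal.ofReal_mul (by positivity), ← ENNReal.ofReal_mul (by positivity)]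
        congr 1
        rw [Real.mul_rpow (by norm_num) this]
        have e1 : (2:ℝ) ^ p = 2 ^ (p - 1) * 2 := by
          rw [← Real.rpow_add_one (by norm_num)]; simp
        have e2 : (f x) ^ p = f x ^ (p - 1) * f x := by
          rcases this.eq_or_lt with h | h
          · rw [← h, Real.zero_rpow (by linarith), mul_zero]
          · rw [← Real.rpow_add_one h.ne']; simp
        rw [e1, e2]
        field_simp
    _ = _ := by rw [lintegral_const_mul' _ _ (by finiteness)]


theorem s9_radial {N : ℕ} (hN : 2 ≤ N) (g : ℝ → ℝ≥0∞) (hg : Measurable g) :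
    ∫⁻ y : EuclideanSpace ℝ (Fin N), g ‖y‖ =
      (N * volume (ball (0 : EuclideanSpace ℝ (Fin N)) 1)) *
        ∫⁻ t in Set.Ioi (0:ℝ), ENNReal.ofReal (t ^ (N - 1)) * g t := by
  rw [s9_polar hN _ (by fun_prop)]
  have hS := (volume : Measure (EuclideanSpace ℝ (Fin N))).toSphere_apply_univ
  rw [finrank_euclideanSpace_fin] at hS
  rw [← hS, mul_comm, ← lintegral_const]
  apply lintegral_congr
  intro θ
  apply setLIntegral_congr_fun measurableSet_Ioi
  intro t ht
  have ht' : 0 < t := ht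
  have hθ : ‖(θ : EuclideanSpace ℝ (Fin N))‖ = 1 := by simp
  simp only [norm_smul, hθ, mul_one, Real.norm_eq_abs, abs_of_pos ht']

theorem s9_kernel {N : ℕ} (hN : 2 ≤ N) (p r : ℝ) (hp : 1 < p) (hpN : p < N) (hr : 0 < r) :
    ∫⁻ y in (ball (0 : EuclideanSpace ℝ (Fin N)) r)ᶜ, ENNReal.ofReal (‖y‖ ^ (1 - N : ℝ)) ^ (p / (p - 1)) =
      ENNReal.ofReal (N * (volume (ball (0 : EuclideanSpace ℝ (Fin N)) 1)).toReal * ((p - 1) / (N - p)) * r ^ (-((N - p)/(p - 1)))) := by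
  have hp1 : 0 < p - 1 := by linarith
  have hNp : 0 < (N:ℝ) - p := by linarith
  have e : ∀ y : EuclideanSpace ℝ (Fin N), ((ball (0 : EuclideanSpace ℝ (Fin N)) r)ᶜ).indicator
      (fun y => ENNReal.ofReal (‖y‖ ^ (1 - N : ℝ)) ^ (p / (p - 1))) y =
      (Set.Ici r).indicator (fun t : ℝ => ENNReal.ofReal (t ^ (1 - N : ℝ)) ^ (p / (p - 1))) ‖y‖ := by
    intro y
    by_cases h : r ≤ ‖y‖
    · rw [Set.indicator_of_mem (by simpa using h), Set.indicator_of_mem (by simpa using h)]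
    · rw [Set.indicator_of_notMem (by simpa using h), Set.indicator_of_notMem (by simpa using h)]
  rw [← lintegral_indicator (by measurability)]
  simp_rw [e]
  rw [s9_radial hN _ (Measurable.indicator (by fun_prop) measurableSet_Ici)]
  have e2 : ∫⁻ t in Set.Ioi (0:ℝ), ENNReal.ofReal (t ^ (N - 1)) *
      (Set.Ici r).indicator (fun t : ℝ => ENNReal.ofReal (t ^ (1 - N : ℝ)) ^ (p / (p - 1))) t
      = ∫⁻ t in Set.Ioi r, ENNReal.ofReal (t ^ (-1 - (N - p) / (p - 1))) := by
    have : ∀ t, ENNReal.ofReal (t ^ (N - 1)) *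
      (Set.Ici r).indicator (fun t : ℝ => ENNReal.ofReal (t ^ (1 - N : ℝ)) ^ (p / (p - 1))) t =
      (Set.Ici r).indicator (fun t : ℝ => ENNReal.ofReal (t ^ (N - 1)) * ENNReal.ofReal (t ^ (1 - N : ℝ)) ^ (p / (p - 1))) t := by
      intro t
      by_cases h : t ∈ Set.Ici r <;> simp [h]
    simp_rw [this]
    rw [setLIntegral_indicator measurableSet_Ici, Set.inter_eq_left.2, restrict_Ioi_eq_restrict_Ici]
    · apply setLIntegral_congr_fun measurableSet_Ici
      intro t ht
      have ht' : 0 < t := lt_of_lt_of_le hr ht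
      dsimp only
      rw [ENNReal.ofReal_rpow_of_pos (by positivity), ← ENNReal.ofReal_mul (by positivity), ← Real.rpow_natCast,
        ← Real.rpow_mul ht'.le, ← Real.rpow_add ht', Nat.cast_sub (by omega)]
      congr 2
      push_cast
      field_simp
      ring
    · intro t ht
      exact lt_of_lt_of_le hr ht
  have ha : 0 < ((N:ℝ) - p) / (p - 1) := by positivity
  rw [e2, ← ofReal_integral_eq_lintegral_ofReal (integrableOn_Ioi_rpow_of_lt (by linarith) hr)]
  · rw [integral_Ioi_rpow_of_lt (by linarith) hr]
    rw [mul_assoc ((N:ℝ) * _), ENNReal.ofReal_mul (by positivity), ENNReal.ofReal_mul (by positivity), ENNReal.ofReal_toReal measure_ball_lt_top.ne,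
      ENNReal.ofReal_natCast]
    congr 2
    rw [show -1 - ((N:ℝ) - p) / (p - 1) + 1 = -((N - p) / (p - 1)) by ring]
    field_simp
  · filter_upwards [ae_restrict_mem measurableSet_Ioi] with t ht
    exact Real.rpow_nonneg (hr.trans ht).le _

theorem s9_far {N : ℕ} (hN : 2 ≤ N) (F : EuclideanSpace ℝ (Fin N) → ℝ≥0∞) (hF : Measurable F)
    (p r : ℝ) (hp : 1 < p) (hpN : p < N) (hr : 0 < r) (x) :
    ∫⁻ y in (ball (0 : EuclideanSpace ℝ (Fin N)) r)ᶜ, ENNReal.ofReal (‖y‖ ^ (1 - N : ℝ)) * F (x + y) ≤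
      ENNReal.ofReal ((N * (volume (ball (0 : EuclideanSpace ℝ (Fin N)) 1)).toReal * ((p - 1) / (N - p))) ^ ((p - 1) / p)
        * r ^ (-((N - p) / p))) * (∫⁻ y, F y ^ p) ^ (1 / p) := by
  have hp1 : 0 < p - 1 := by linarith
  have hp0 : 0 < p := by linarith
  have hNp : 0 < (N:ℝ) - p := by linarith
  have hc : (p / (p - 1)).HolderConjugate p := (Real.HolderConjugate.conjExponent hp).symm
  refine (ENNReal.lintegral_mul_le_Lp_mul_Lq _ hc (f := fun y => ENNReal.ofReal (‖y‖ ^ (1 - N : ℝ)))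
    (g := fun y => F (x + y)) (by fun_prop) (by fun_prop)).trans ?_
  apply mul_le_mul'
  · rw [s9_kernel hN p r hp hpN hr, ENNReal.ofReal_rpow_of_nonneg (by positivity) (by positivity)]
    apply ENNReal.ofReal_le_ofReal
    rw [Real.mul_rpow (by positivity) (by positivity), ← Real.rpow_mul hr.le]
    apply le_of_eq
    congr 2
    · field_simp
    · field_simp
  · apply ENNReal.rpow_le_rpow _ (by positivity)
    refine (setLIntegral_le_lintegral _ _).trans ?_
    rw [lintegral_add_left_eq_self (fun y => F y ^ p) x]

theorem s9_near {N : ℕ} (hN : 2 ≤ N) (F : EuclideanSpace ℝ (Fin N) → ℝ≥0∞) (hF : Measurable F)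
    (r : ℝ) (hr : 0 < r) (x) :
    ∫⁻ y in ball (0 : EuclideanSpace ℝ (Fin N)) r, ENNReal.ofReal (‖y‖ ^ (1 - N : ℝ)) * F (x + y) ≤
      ENNReal.ofReal (2 ^ (N + 1) * (volume (ball (0 : EuclideanSpace ℝ (Fin N)) 1)).toReal * r) * s9M F x := by
  obtain ⟨n, hn1, hn2⟩ := exists_mem_Ico_zpow hr (one_lt_two)
  set ω := volume (ball (0 : EuclideanSpace ℝ (Fin N)) 1) with hω
  set m : ℤ := n + 1 with hm
  have hNr : (1 - (N:ℝ)) ≤ 0 := by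
    have : (2:ℝ) ≤ N := by exact_mod_cast hN
    linarith
  have hpt : ∀ y ∈ ball (0 : EuclideanSpace ℝ (Fin N)) r, ENNReal.ofReal (‖y‖ ^ (1 - N : ℝ)) * F (x + y) ≤
      ∑' j : ℕ, ENNReal.ofReal (((2:ℝ) ^ (m - j - 1)) ^ (1 - N : ℝ)) *
        (closedBall x ((2:ℝ) ^ (m - j))).indicator F (x + y) := by
    intro y hy
    rcases eq_or_ne y 0 with h0 | h0
    · have : (0:ℝ) ^ (1 - N : ℝ) = 0 := Real.zero_rpow (by
        have : (2:ℝ) ≤ N := by exact_mod_cast hN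
        linarith)
      simp [h0, this]
    · have hy0 : 0 < ‖y‖ := norm_pos_iff.2 h0
      obtain ⟨l, hl1, hl2⟩ := exists_mem_Ico_zpow hy0 (one_lt_two)
      have hlm : l < m := by
        have h1 : (2:ℝ) ^ l < 2 ^ m := by
          have : ‖y‖ < r := by simpa using hy
          linarith
        exact (zpow_lt_zpow_iff_right₀ one_lt_two).1 h1
      obtain ⟨j, hj⟩ : ∃ j : ℕ, (j : ℤ) = m - l - 1 := ⟨(m - l - 1).toNat, by omega⟩
      refine le_trans ?_ (ENNReal.le_tsum j)
      rw [show m - j - 1 = l by omega, show m - j = l + 1 by omega]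
      rw [Set.indicator_of_mem (by simpa using hl2.le)]
      gcongr ?_ * _
      apply ENNReal.ofReal_le_ofReal
      exact Real.rpow_le_rpow_of_nonpos (by positivity) hl1 hNr
  calc _ ≤ ∫⁻ y in ball (0 : EuclideanSpace ℝ (Fin N)) r, ∑' j : ℕ, ENNReal.ofReal (((2:ℝ) ^ (m - j - 1)) ^ (1 - N : ℝ)) *
        (closedBall x ((2:ℝ) ^ (m - j))).indicator F (x + y) := setLIntegral_mono' measurableSet_ball hpt
    _ ≤ ∫⁻ y, ∑' j : ℕ, ENNReal.ofReal (((2:ℝ) ^ (m - j - 1)) ^ (1 - N : ℝ)) *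
        (closedBall x ((2:ℝ) ^ (m - j))).indicator F (x + y) := setLIntegral_le_lintegral _ _
    _ = ∫⁻ y, ∑' j : ℕ, ENNReal.ofReal (((2:ℝ) ^ (m - j - 1)) ^ (1 - N : ℝ)) *
        (closedBall x ((2:ℝ) ^ (m - j))).indicator F y :=
        lintegral_add_left_eq_self (fun y => ∑' j : ℕ, ENNReal.ofReal (((2:ℝ) ^ (m - j - 1)) ^ (1 - N : ℝ)) *
        (closedBall x ((2:ℝ) ^ (m - j))).indicator F y) x
    _ = ∑' j : ℕ, ENNReal.ofReal (((2:ℝ) ^ (m - j - 1)) ^ (1 - N : ℝ)) *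
        ∫⁻ y in closedBall x ((2:ℝ) ^ (m - j)), F y := by
        rw [lintegral_tsum]
        · congr 1
          ext j
          rw [lintegral_const_mul' _ _ (by finiteness), lintegral_indicator measurableSet_closedBall]
        · intro j
          exact ((hF.indicator measurableSet_closedBall).const_mul _).aemeasurable
    _ ≤ ∑' j : ℕ, ENNReal.ofReal (((2:ℝ) ^ (m - j - 1)) ^ (1 - N : ℝ)) *
        (volume (closedBall x ((2:ℝ) ^ (m - j))) * s9M F x) := by
        gcongr with j
        have hv := s9_vol_ne x (m - j)
        have := le_iSup (fun k : ℤ => (∫⁻ y in closedBall x ((2:ℝ) ^ k), F y) / volume (closedBall x ((2:ℝ) ^ k))) (m - j)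
        rw [ENNReal.div_le_iff hv.1 hv.2, mul_comm] at this
        exact this
    _ = ∑' j : ℕ, ENNReal.ofReal ((2:ℝ) ^ N * (2:ℝ) ^ n * (1 / 2) ^ j) * (ω * s9M F x) := by
        congr 1
        ext j
        rw [s9_vol _ (by positivity), mul_assoc (ENNReal.ofReal _) _ (s9M F x), ← mul_assoc, ← ENNReal.ofReal_mul (by positivity)]
        congr 2
        rw [← Real.rpow_natCast (_ ^ (m - j)), ← Real.rpow_intCast, ← Real.rpow_intCast, ← Real.rpow_mul (by norm_num), ← Real.rpow_mul (by norm_num),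
          ← Real.rpow_add (by norm_num), one_div, inv_pow, ← Real.rpow_natCast, ← Real.rpow_natCast, ← Real.rpow_neg (by norm_num), ← Real.rpow_intCast,
          ← Real.rpow_add (by norm_num), ← Real.rpow_add (by norm_num)]
        congr 1
        rw [hm]
        push_cast
        ring
    _ = ENNReal.ofReal ((2:ℝ) ^ N * (2:ℝ) ^ n * 2) * (ω * s9M F x) := by
        rw [ENNReal.tsum_mul_right, ← ENNReal.ofReal_tsum_of_nonneg (fun _ => by positivity)
          (summable_geometric_two.mul_left _), tsum_mul_left, tsum_geometric_two]
    _ ≤ ENNReal.ofReal ((2:ℝ) ^ N * r * 2) * (ω * s9M F x) := by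
        gcongr
    _ = _ := by
        rw [show (2:ℝ) ^ (N + 1) * ω.toReal * r = (2 ^ N * r * 2) * ω.toReal by ring,
          ENNReal.ofReal_mul (p := 2 ^ N * r * 2) (by positivity), ENNReal.ofReal_toReal measure_ball_lt_top.ne, ← hω]
        ring

theorem s9_opt (A C w i m p n : ℝ) (hA : 0 ≤ A) (hC : 0 ≤ C) (hi : 0 ≤ i) (hm : 0 ≤ m) (hp : 1 < p) (hpn : p < n)
    (h : ∀ r : ℝ, 0 < r → w ≤ A * r ^ (-((n - p) / p)) * i + C * r * m) :
    w ≤ (A + C) * (i ^ (p / n) * m ^ ((n - p) / n)) := by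
  have key : ∀ ε : ℝ, 0 < ε → w ≤ (A + C) * ((i + ε) ^ (p / n) * (m + ε) ^ ((n - p) / n)) := by
    intro ε hε
    have hn0 : n ≠ 0 := by linarith
    have hp0 : p ≠ 0 := by linarith
    have hi' : 0 < i + ε := by linarith
    have hm' : 0 < m + ε := by linarith
    have hr : 0 < ((i + ε) / (m + ε)) ^ (p / n) := by positivity
    refine (h _ hr).trans ?_
    have e1 : (((i + ε) / (m + ε)) ^ (p / n)) ^ (-((n - p) / p)) * (i + ε) = (i + ε) ^ (p / n) * (m + ε) ^ ((n - p) / n) := by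
      rw [← Real.rpow_mul (by positivity), Real.div_rpow hi'.le hm'.le, show p / n * (-((n - p) / p)) = -((n - p) / n) by field_simp,
        Real.rpow_neg hm'.le, show p / n = -((n-p)/n) + 1 by field_simp; ring, Real.rpow_add_one hi'.ne']
      field_simp
    have e2 : ((i + ε) / (m + ε)) ^ (p / n) * (m + ε) = (i + ε) ^ (p / n) * (m + ε) ^ ((n - p) / n) := by
      rw [Real.div_rpow hi'.le hm'.le, show (n - p) / n = -(p / n) + 1 by field_simp; ring, Real.rpow_add_one hm'.ne', Real.rpow_neg hm'.le]
      field_simp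
    calc _ ≤ A * (((i + ε) / (m + ε)) ^ (p / n)) ^ (-((n - p) / p)) * (i + ε) + C * ((i + ε) / (m + ε)) ^ (p / n) * (m + ε) := by
          gcongr <;> linarith
      _ = _ := by
          rw [mul_assoc, e1, mul_assoc, e2]; ring
  have hcont : Tendsto (fun ε : ℝ => (A + C) * ((i + ε) ^ (p / n) * (m + ε) ^ ((n - p) / n))) (𝓝[>] 0)
      (𝓝 ((A + C) * (i ^ (p / n) * m ^ ((n - p) / n)))) := by
    have : Continuous (fun ε : ℝ => (A + C) * ((i + ε) ^ (p / n) * (m + ε) ^ ((n - p) / n))) := by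
      have h1 : 0 ≤ p / n := by apply div_nonneg <;> linarith
      have h2 : 0 ≤ (n - p) / n := by apply div_nonneg <;> linarith
      refine continuous_const.mul (Continuous.mul ?_ ?_)
      · exact (Real.continuous_rpow_const h1).comp (by fun_prop)
      · exact (Real.continuous_rpow_const h2).comp (by fun_prop)
    have := this.tendsto 0
    simp only [add_zero] at this
    exact this.mono_left nhdsWithin_le_nhds
  exact ge_of_tendsto hcont (eventually_nhdsWithin_of_forall key)

theorem s9_sobolev {N : ℕ} (hN : 2 ≤ N) (u : EuclideanSpace ℝ (Fin N) → ℝ) (hu : ContDiff ℝ 1 u)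
    (hc : HasCompactSupport u) (p : ℝ) (hp : 1 < p) (hpN : p < N) (ω : ℝ)
    (hω : ω = (volume (ball (0 : EuclideanSpace ℝ (Fin N)) 1)).toReal) :
    ∫⁻ x, ‖u x‖ₑ ^ (N * p / (N - p)) ≤
      ENNReal.ofReal (((N * ω * ((p - 1) / (N - p))) ^ ((p - 1) / p) + 2 ^ (N + 1) * ω) / (N * ω)) ^ (N * p / (N - p)) *
      ENNReal.ofReal (p * 5 ^ N * 2 ^ p / (p - 1)) * (∫⁻ x, ‖fderiv ℝ u x‖ₑ ^ p) ^ (N / (N - p)) := by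
  have hp1 : 0 < p - 1 := by linarith
  have hp0 : 0 < p := by linarith
  have hNp : 0 < (N:ℝ) - p := by linarith
  have hN0 : 0 < (N:ℝ) := by linarith
  have hω0 : 0 < ω := by
    rw [hω]; exact ENNReal.toReal_pos (measure_ball_pos _ _ one_pos).ne' measure_ball_lt_top.ne
  have hωe : volume (ball (0 : EuclideanSpace ℝ (Fin N)) 1) = ENNReal.ofReal ω := by
    rw [hω, ENNReal.ofReal_toReal measure_ball_lt_top.ne]
  set f : EuclideanSpace ℝ (Fin N) → ℝ := fun y => ‖fderiv ℝ u y‖ with hf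
  have hfc : Continuous f := (hu.continuous_fderiv (by norm_num)).norm
  have hfs : HasCompactSupport f := (hc.fderiv ℝ).norm
  set F : EuclideanSpace ℝ (Fin N) → ℝ≥0∞ := fun y => ENNReal.ofReal (f y) with hF
  have hFe : ∀ y, ‖fderiv ℝ u y‖ₑ = F y := fun y => (ofReal_norm _).symm
  have hFm : Measurable F := by
    have := hfc.measurable
    fun_prop
  obtain ⟨K, hK⟩ := hfs.exists_bound_of_continuous hfc
  have hK' : ∀ x, f x ≤ K := fun x => (le_abs_self _).trans (hK x)
  have hFI : ∫⁻ y, F y ≠ ⊤ := by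
    have := (hfc.integrable_of_hasCompactSupport hfs (μ := volume)).lintegral_lt_top
    exact this.ne
  set J : ℝ≥0∞ := ∫⁻ y, F y ^ p with hJ
  have hJt : J ≠ ⊤ := by
    have h1 : Continuous fun y => f y ^ p := hfc.rpow_const (fun _ => Or.inr hp0.le)
    have h2 : HasCompactSupport fun y => f y ^ p :=
      hfs.comp_left (g := fun t : ℝ => t ^ p) (Real.zero_rpow hp0.ne')
    have := (h1.integrable_of_hasCompactSupport h2 (μ := volume)).lintegral_lt_top
    rw [hJ]
    simp only [hF]
    simp_rw [fun y => ENNReal.ofReal_rpow_of_nonneg (show 0 ≤ f y from norm_nonneg _) hp0.le]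
    exact this.ne
  have hIt : J ^ (1 / p) ≠ ⊤ := ENNReal.rpow_ne_top_of_nonneg (by positivity) hJt
  have hMt : ∀ x, s9M F x ≠ ⊤ := fun x =>
    ((s9M_le F (ENNReal.ofReal K) (fun x => ENNReal.ofReal_le_ofReal (hK' x)) x).trans_lt ENNReal.ofReal_lt_top).ne
  set A := (N * ω * ((p - 1) / (N - p))) ^ ((p - 1) / p) with hA
  set C := 2 ^ (N + 1) * ω with hC
  have hA0 : 0 ≤ A := by positivity
  have hC0 : 0 ≤ C := by positivity
  have hpt : ∀ x, ‖u x‖ₑ ≤ ENNReal.ofReal ((A + C) / (N * ω)) * ((J ^ (1 / p)) ^ (p / N) * s9M F x ^ ((N - p) / N)) := by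
    intro x
    have h1 : ∀ r : ℝ, 0 < r → N * ω * ‖u x‖ ≤ A * r ^ (-((N - p) / p)) * (J ^ (1 / p)).toReal + C * r * (s9M F x).toReal := by
      intro r hr
      have h2 := s9_potential hN u hu hc x
      simp only [hFe] at h2
      rw [← lintegral_add_compl _ (measurableSet_ball (x := (0 : EuclideanSpace ℝ (Fin N))) (ε := r))] at h2
      have h3 := h2.trans (add_le_add (s9_near hN F hFm r hr x) (s9_far hN F hFm p r hp hpN hr x))
      rw [← hω, ← hA, ← hC, hωe, ← ENNReal.ofReal_natCast, ← ofReal_norm (u x), ← ENNReal.ofReal_mul (by positivity),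
        ← ENNReal.ofReal_mul (by positivity), ← ENNReal.ofReal_toReal hIt, ← ENNReal.ofReal_toReal (hMt x),
        ← ENNReal.ofReal_mul (by positivity), ← ENNReal.ofReal_mul (by positivity),
        ← ENNReal.ofReal_add (by positivity) (by positivity), ENNReal.ofReal_le_ofReal_iff (by positivity)] at h3
      linarith
    have h4 := s9_opt A C _ _ _ p N hA0 hC0 ENNReal.toReal_nonneg ENNReal.toReal_nonneg hp hpN h1
    have h5 : ‖u x‖ ≤ ((A + C) / (N * ω)) * ((J ^ (1 / p)).toReal ^ (p / N) * (s9M F x).toReal ^ ((N - p) / N)) := by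
      rw [div_mul_eq_mul_div, le_div_iff₀ (by positivity)]
      linarith
    rw [← ofReal_norm, ← ENNReal.ofReal_toReal hIt, ← ENNReal.ofReal_toReal (hMt x),
      ENNReal.ofReal_rpow_of_nonneg ENNReal.toReal_nonneg (by positivity),
      ENNReal.ofReal_rpow_of_nonneg ENNReal.toReal_nonneg (by positivity), ← ENNReal.ofReal_mul (by positivity),
      ← ENNReal.ofReal_mul (by positivity)]
    exact ENNReal.ofReal_le_ofReal h5
  set s : ℝ := N * p / (N - p) with hs
  have hs0 : 0 < s := by positivity
  calc ∫⁻ x, ‖u x‖ₑ ^ s ≤ ∫⁻ x, ENNReal.ofReal ((A + C) / (N * ω)) ^ s * J ^ (p / (N - p)) * s9M F x ^ p := by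
        apply lintegral_mono
        intro x
        refine (ENNReal.rpow_le_rpow (hpt x) hs0.le).trans ?_
        dsimp only
        rw [ENNReal.mul_rpow_of_nonneg _ _ hs0.le, ENNReal.mul_rpow_of_nonneg _ _ hs0.le, ← ENNReal.rpow_mul, ← ENNReal.rpow_mul,
          ← ENNReal.rpow_mul, mul_assoc]
        apply le_of_eq
        congr 3
        · rw [hs]; field_simp
        · rw [hs]; field_simp
    _ = ENNReal.ofReal ((A + C) / (N * ω)) ^ s * J ^ (p / (N - p)) * ∫⁻ x, s9M F x ^ p := by
        rw [lintegral_const_mul _ ((s9M_measurable F hFm).pow_const _)]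
    _ ≤ ENNReal.ofReal ((A + C) / (N * ω)) ^ s * J ^ (p / (N - p)) * (ENNReal.ofReal (p * 5 ^ N * 2 ^ p / (p - 1)) * J) := by
        gcongr
        exact s9_strong hN f hfc.measurable (fun _ => norm_nonneg _) K hK' hFI p hp
    _ = _ := by
        simp only [hFe]
        rw [← hJ, show (N:ℝ) / (N - p) = p / (N - p) + 1 by field_simp; ring,
          ENNReal.rpow_add_of_nonneg _ _ (by positivity) (by norm_num), ENNReal.rpow_one]
        ring


theorem s9_step (s0 s1 η : ℝ) (h : s0 < s1) (hη : 1 < η) :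
    ∃ g : ℝ → ℝ, ContDiff ℝ (⊤ : ℕ∞) g ∧ (∀ s ≤ s0, g s = 0) ∧ (∀ s, s1 ≤ s → g s = 1) ∧
      ∀ s, |deriv g s| ≤ η / (s1 - s0) := by
  have hd : 0 < s1 - s0 := by linarith
  let b : ContDiffBump ((s0 + s1) / 2 : ℝ) :=
    { rIn := (s1 - s0) / 2 / η
      rOut := (s1 - s0) / 2
      rIn_pos := by positivity
      rIn_lt_rOut := div_lt_self (by positivity) hη }
  have hbc : Continuous b := b.continuous
  have hb0 : ∀ s, s ≤ s0 → b s = 0 := fun s hs => by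
    apply b.zero_of_le_dist
    rw [Real.dist_eq, abs_of_nonpos (by linarith)]
    show (s1 - s0) / 2 ≤ _
    linarith
  have hb1 : ∀ s, s1 ≤ s → b s = 0 := fun s hs => by
    apply b.zero_of_le_dist
    rw [Real.dist_eq, abs_of_nonneg (by linarith)]
    show (s1 - s0) / 2 ≤ _
    linarith
  have hI : (s1 - s0) / η ≤ ∫ x, b x := by
    have h1 := b.measure_closedBall_le_integral (volume : Measure ℝ)
    have h2 : (volume : Measure ℝ).real (closedBall ((s0 + s1) / 2 : ℝ) b.rIn) = (s1 - s0) / η := by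
      rw [Real.volume_real_closedBall (by exact b.rIn_pos.le)]
      show 2 * ((s1 - s0) / 2 / η) = _
      ring
    linarith
  have hIpos : 0 < ∫ x, b x := lt_of_lt_of_le (by positivity) hI
  have hder : ∀ s, HasDerivAt (fun s => (∫ t in s0..s, b t) / ∫ x, b x) (b s / ∫ x, b x) s := fun s =>
    (intervalIntegral.integral_hasDerivAt_right (hbc.intervalIntegrable _ _)
      hbc.stronglyMeasurable.stronglyMeasurableAtFilter hbc.continuousAt).div_const _
  have hderiv : deriv (fun s => (∫ t in s0..s, b t) / ∫ x, b x) = fun s => b s / ∫ x, b x :=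
    funext fun s => (hder s).deriv
  have hfull : ∫ x, b x = ∫ t in s0..s1, b t := by
    rw [intervalIntegral.integral_of_le h.le]
    symm
    apply setIntegral_eq_integral_of_forall_compl_eq_zero
    intro x hx
    by_cases hx0 : x ≤ s0
    · exact hb0 x hx0
    · apply hb1
      by_contra hc
      exact hx ⟨by linarith, by linarith⟩
  refine ⟨fun s => (∫ t in s0..s, b t) / ∫ x, b x, ?_, ?_, ?_, ?_⟩
  · rw [contDiff_infty_iff_deriv]
    refine ⟨fun s => (hder s).differentiableAt, ?_⟩
    rw [hderiv]
    exact b.contDiff.div_const _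
  · intro s hs
    dsimp only
    rw [intervalIntegral.integral_symm, intervalIntegral.integral_of_le hs,
      setIntegral_eq_zero_of_forall_eq_zero (fun x hx => hb0 x hx.2)]
    simp
  · intro s hs
    dsimp only
    rw [← intervalIntegral.integral_add_adjacent_intervals (hbc.intervalIntegrable s0 s1) (hbc.intervalIntegrable s1 s),
      intervalIntegral.integral_of_le hs, setIntegral_eq_zero_of_forall_eq_zero (fun x hx => hb1 x hx.1.le), add_zero,
      ← hfull, div_self hIpos.ne']
  · intro s
    rw [hderiv]
    dsimp only
    rw [abs_of_nonneg (div_nonneg b.nonneg hIpos.le)]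
    calc b s / ∫ x, b x ≤ 1 / ((s1 - s0) / η) := by
          gcongr
          exact b.le_one
      _ = _ := by field_simp

theorem s9_test {N : ℕ} (hN : 2 ≤ N) (x0 : EuclideanSpace ℝ (Fin N)) (p δ R η : ℝ) (hp : 1 < p) (hpN : p < N)
    (hδ : 0 < δ) (hδR : δ < R) (hη : 1 < η) :
    ∃ u : EuclideanSpace ℝ (Fin N) → ℝ, ContDiff ℝ (⊤ : ℕ∞) u ∧ HasCompactSupport u ∧
      tsupport u ⊆ closedBall x0 R ∧ (∀ x ∈ ball x0 δ, u x = 1) ∧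
      ∫⁻ x, ‖fderiv ℝ u x‖ₑ ^ p ≤ ENNReal.ofReal (η ^ p * (N * (volume (ball (0 : EuclideanSpace ℝ (Fin N)) 1)).toReal) *
        ((N - p) / (p - 1)) ^ (p - 1) * (δ ^ (-((N - p) / (p - 1))) - R ^ (-((N - p) / (p - 1)))) ^ (1 - p)) := by
  have hp1 : 0 < p - 1 := by linarith
  have hp0 : 0 < p := by linarith
  have hNp : 0 < (N:ℝ) - p := by linarith
  set a := ((N:ℝ) - p) / (p - 1) with ha
  have ha0 : 0 < a := by positivity
  have hR : 0 < R := hδ.trans hδR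
  have hs : R ^ (-a) < δ ^ (-a) := Real.rpow_lt_rpow_of_neg hδ hδR (by linarith)
  obtain ⟨g, hg, hg0, hg1, hgd⟩ := s9_step (R ^ (-a)) (δ ^ (-a)) η hs hη
  set L := η / (δ ^ (-a) - R ^ (-a)) with hL
  have hd : 0 < δ ^ (-a) - R ^ (-a) := by linarith
  have hL0 : 0 < L := by positivity
  let u : EuclideanSpace ℝ (Fin N) → ℝ := fun x => if ‖x - x0‖ < δ then 1 else g (‖x - x0‖ ^ (-a))
  have hu1 : ∀ x ∈ ball x0 δ, u x = 1 := fun x hx => by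
    rw [mem_ball, dist_eq_norm] at hx
    simp [u, hx]
  have hug : ∀ x, x ≠ x0 → u x = g (‖x - x0‖ ^ (-a)) := by
    intro x hx
    have hpos : 0 < ‖x - x0‖ := norm_pos_iff.2 (sub_ne_zero.2 hx)
    by_cases h : ‖x - x0‖ < δ
    · simp only [u, h, if_true]
      rw [hg1]
      exact Real.rpow_le_rpow_of_nonpos hpos h.le (by linarith)
    · simp [u, h]
  have hu0 : ∀ x, R ≤ ‖x - x0‖ → u x = 0 := by
    intro x hx
    have hne : x ≠ x0 := by
      rintro rfl
      simp at hx
      linarith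
    rw [hug x hne, hg0]
    exact Real.rpow_le_rpow_of_nonpos hR hx (by linarith)
  have hev1 : ∀ x ∈ ball x0 δ, u =ᶠ[𝓝 x] fun _ => 1 := fun x hx => by
    filter_upwards [isOpen_ball.mem_nhds hx] with y hy using hu1 y hy
  have hevg : ∀ x, x ≠ x0 → u =ᶠ[𝓝 x] fun x => g (‖x - x0‖ ^ (-a)) := fun x hx => by
    filter_upwards [isOpen_ne.mem_nhds hx] with y hy using hug y hy
  have hsm : ContDiff ℝ (⊤ : ℕ∞) u := by
    rw [contDiff_iff_contDiffAt]
    intro x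
    by_cases hx : x = x0
    · exact contDiffAt_const.congr_of_eventuallyEq (hev1 x (by simp [hx, hδ]))
    · refine ContDiffAt.congr_of_eventuallyEq ?_ (hevg x hx)
      have hne : x - x0 ≠ 0 := sub_ne_zero.2 hx
      have h1 : ContDiffAt ℝ (⊤ : ℕ∞) (fun x : EuclideanSpace ℝ (Fin N) => ‖x - x0‖) x :=
        (contDiffAt_id.sub contDiffAt_const).norm ℝ hne
      exact hg.contDiffAt.comp x (h1.rpow_const_of_ne (norm_ne_zero_iff.2 hne))
  have hts : tsupport u ⊆ closedBall x0 R := by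
    apply closure_minimal _ isClosed_closedBall
    intro x hx
    by_contra hc
    apply hx
    apply hu0
    rw [mem_closedBall, dist_eq_norm] at hc
    linarith
  have hcs : HasCompactSupport u := (isCompact_closedBall x0 R).of_isClosed_subset (isClosed_tsupport _) hts
  have hgr : ∀ x, ‖fderiv ℝ u x‖ₑ ^ p ≤ (fun t : ℝ => (Set.Icc δ R).indicator (fun t => ENNReal.ofReal ((L * (a * t ^ (-a - 1))) ^ p)) t) ‖x - x0‖ := by
    intro x
    have hz : ‖(0 : EuclideanSpace ℝ (Fin N) →L[ℝ] ℝ)‖ₑ ^ p = 0 := by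
      rw [← ofReal_norm, norm_zero, ENNReal.ofReal_zero, ENNReal.zero_rpow_of_pos hp0]
    dsimp only
    by_cases h1 : ‖x - x0‖ < δ
    · rw [(hev1 x (by rwa [mem_ball, dist_eq_norm])).fderiv_eq]
      rw [fderiv_fun_const, Pi.zero_apply, hz]
      exact bot_le
    · by_cases h2 : R < ‖x - x0‖
      · have : u =ᶠ[𝓝 x] fun _ => 0 := by
          have hop : IsOpen {x | R < ‖x - x0‖} := isOpen_lt continuous_const (by fun_prop)
          filter_upwards [hop.mem_nhds h2] with y hy using hu0 y (le_of_lt hy)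
        rw [this.fderiv_eq, fderiv_fun_const, Pi.zero_apply, hz]
        exact bot_le
      · rw [Set.indicator_of_mem (by exact ⟨not_lt.1 h1, not_lt.1 h2⟩)]
        have hpos : 0 < ‖x - x0‖ := lt_of_lt_of_le hδ (not_lt.1 h1)
        have hne : x - x0 ≠ 0 := norm_pos_iff.1 hpos
        rw [← ofReal_norm, ENNReal.ofReal_rpow_of_nonneg (norm_nonneg _) hp0.le]
        apply ENNReal.ofReal_le_ofReal
        apply Real.rpow_le_rpow (norm_nonneg _) _ hp0.le
        rw [(hevg x (sub_ne_zero.1 hne)).fderiv_eq]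
        have d1 : DifferentiableAt ℝ (fun x : EuclideanSpace ℝ (Fin N) => ‖x - x0‖) x :=
          (differentiableAt_id.sub (differentiableAt_const _)).norm ℝ hne
        have l1 : ‖fderiv ℝ (fun x : EuclideanSpace ℝ (Fin N) => ‖x - x0‖) x‖ ≤ 1 := by
          have : LipschitzWith 1 (fun x : EuclideanSpace ℝ (Fin N) => ‖x - x0‖) := by
            apply LipschitzWith.of_dist_le_mul
            intro y z
            rw [Real.dist_eq, dist_eq_norm]
            simpa using abs_norm_sub_norm_le (y - x0) (z - x0)
          simpa using norm_fderiv_le_of_lipschitz ℝ this (x₀ := x)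
        have d2 : HasDerivAt (fun t : ℝ => t ^ (-a)) (-a * ‖x - x0‖ ^ (-a - 1)) ‖x - x0‖ :=
          Real.hasDerivAt_rpow_const (Or.inl hpos.ne')
        have d3 : HasDerivAt g (deriv g (‖x - x0‖ ^ (-a))) (‖x - x0‖ ^ (-a)) :=
          (hg.differentiable (by simp) _).hasDerivAt
        have d4 := HasDerivAt.comp ‖x - x0‖ d3 d2
        have d5 := d4.comp_hasFDerivAt x d1.hasFDerivAt
        have d6 := d5.fderiv
        have d7 : (fun x => g (‖x - x0‖ ^ (-a))) = ((g ∘ fun t : ℝ => t ^ (-a)) ∘ fun x : EuclideanSpace ℝ (Fin N) => ‖x - x0‖) := rfl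
        rw [d7, d6, norm_smul]
        calc _ ≤ ‖deriv g (‖x - x0‖ ^ (-a)) * (-a * ‖x - x0‖ ^ (-a - 1))‖ * 1 := by gcongr
          _ = |deriv g (‖x - x0‖ ^ (-a))| * (a * ‖x - x0‖ ^ (-a - 1)) := by
            rw [mul_one, norm_mul, norm_mul, norm_neg, Real.norm_eq_abs, Real.norm_eq_abs, Real.norm_eq_abs, abs_of_pos ha0, abs_of_nonneg (by positivity : 0 ≤ ‖x - x0‖ ^ (-a - 1))]
          _ ≤ _ := by
            gcongr
            exact hgd _
  refine ⟨u, hsm, hcs, hts, hu1, ?_⟩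
  have hmeas : Measurable (fun t : ℝ => (Set.Icc δ R).indicator (fun t => ENNReal.ofReal ((L * (a * t ^ (-a - 1))) ^ p)) t) :=
    Measurable.indicator (by fun_prop) measurableSet_Icc
  refine (lintegral_mono hgr).trans ?_
  rw [lintegral_sub_right_eq_self (fun x : EuclideanSpace ℝ (Fin N) => (fun t : ℝ => (Set.Icc δ R).indicator (fun t => ENNReal.ofReal ((L * (a * t ^ (-a - 1))) ^ p)) t) ‖x‖) x0]
  rw [s9_radial hN _ hmeas]
  have e2 : ∫⁻ t in Set.Ioi (0:ℝ), ENNReal.ofReal (t ^ (N - 1)) *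
      (Set.Icc δ R).indicator (fun t => ENNReal.ofReal ((L * (a * t ^ (-a - 1))) ^ p)) t
      = ∫⁻ t in Set.Ioc δ R, ENNReal.ofReal ((L * a) ^ p * t ^ (-a - 1)) := by
    have : ∀ t, ENNReal.ofReal (t ^ (N - 1)) *
      (Set.Icc δ R).indicator (fun t => ENNReal.ofReal ((L * (a * t ^ (-a - 1))) ^ p)) t =
      (Set.Icc δ R).indicator (fun t : ℝ => ENNReal.ofReal (t ^ (N - 1)) * ENNReal.ofReal ((L * (a * t ^ (-a - 1))) ^ p)) t := by
      intro t
      by_cases h : t ∈ Set.Icc δ R <;> simp [h]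
    simp_rw [this]
    rw [setLIntegral_indicator measurableSet_Icc, Set.inter_eq_left.2, restrict_Ioc_eq_restrict_Icc]
    · apply setLIntegral_congr_fun measurableSet_Icc
      intro t ht
      have ht' : 0 < t := lt_of_lt_of_le hδ ht.1
      dsimp only
      rw [← ENNReal.ofReal_mul (by positivity), ← mul_assoc, Real.mul_rpow (by positivity) (by positivity), ← Real.rpow_natCast,
        ← Real.rpow_mul ht'.le, mul_left_comm, ← Real.rpow_add ht', Nat.cast_sub (by omega)]
      congr 3
      rw [ha]
      push_cast
      field_simp
      ring
    · intro t ht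
      exact lt_of_lt_of_le hδ ht.1
  have hii : IntervalIntegrable (fun t : ℝ => (L * a) ^ p * t ^ (-a - 1)) volume δ R := by
    apply IntervalIntegrable.const_mul
    apply intervalIntegral.intervalIntegrable_rpow
    right
    rw [Set.uIcc_of_le hδR.le]
    intro h
    linarith [h.1]
  rw [e2, ← ofReal_integral_eq_lintegral_ofReal hii.1]
  · rw [← intervalIntegral.integral_of_le hδR.le, intervalIntegral.integral_const_mul, integral_rpow]
    · have e3 : (R ^ (-a - 1 + 1) - δ ^ (-a - 1 + 1)) / (-a - 1 + 1) = (δ ^ (-a) - R ^ (-a)) / a := by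
        rw [show -a - 1 + 1 = -a by ring]
        field_simp
        ring
      rw [e3]
      rw [← ENNReal.ofReal_natCast, ← ENNReal.ofReal_toReal (measure_ball_lt_top.ne : volume (ball (0 : EuclideanSpace ℝ (Fin N)) 1) ≠ ⊤),
        ← ENNReal.ofReal_mul (by positivity), ← ENNReal.ofReal_mul (by positivity), ENNReal.toReal_ofReal ENNReal.toReal_nonneg]
      apply ENNReal.ofReal_le_ofReal
      apply le_of_eq
      rw [hL, Real.mul_rpow (by positivity) ha0.le, Real.div_rpow (by positivity) hd.le, show 1 - p = -(p - 1) by ring, Real.rpow_neg hd.le]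
      have e4 : (δ ^ (-a) - R ^ (-a)) ^ p = (δ ^ (-a) - R ^ (-a)) ^ (p - 1) * (δ ^ (-a) - R ^ (-a)) := by
        rw [← Real.rpow_add_one hd.ne']; simp
      have e5 : a ^ p = a ^ (p - 1) * a := by
        rw [← Real.rpow_add_one ha0.ne']; simp
      rw [e4, e5]
      field_simp
    · right
      refine ⟨by linarith, ?_⟩
      rw [Set.uIcc_of_le hδR.le]
      intro h
      linarith [h.1]
  · filter_upwards [ae_restrict_mem measurableSet_Ioc] with t ht
    have ht' : 0 < t := hδ.trans ht.1
    show 0 ≤ (L * a) ^ p * t ^ (-a - 1)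
    positivity

theorem s9_gradnorm {N : ℕ} (u : EuclideanSpace ℝ (Fin N) → ℝ) (x : EuclideanSpace ℝ (Fin N)) :
    ‖gradient u x‖ = ‖fderiv ℝ u x‖ := by
  simp [gradient]

theorem s9_int {N : ℕ} {F : Type*} [NormedAddCommGroup F] (f : EuclideanSpace ℝ (Fin N) → F) (hf : Continuous f)
    (hc : HasCompactSupport f) (Ω : Set (EuclideanSpace ℝ (Fin N))) (hs : tsupport f ⊆ Ω) (q : ℝ) (hq : 0 < q) :
    ENNReal.ofReal (∫ x in Ω, ‖f x‖ ^ q) = ∫⁻ x, ‖f x‖ₑ ^ q := by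
  have hcont : Continuous fun x => ‖f x‖ ^ q := hf.norm.rpow_const fun _ => Or.inr hq.le
  have hcs : HasCompactSupport fun x => ‖f x‖ ^ q :=
    hc.comp_left (g := fun y : F => ‖y‖ ^ q) (by simp [Real.zero_rpow hq.ne'])
  rw [setIntegral_eq_integral_of_forall_compl_eq_zero]
  · rw [ofReal_integral_eq_lintegral_ofReal (hcont.integrable_of_hasCompactSupport hcs)
      (Eventually.of_forall fun x => by positivity)]
    congr 1
    ext x
    rw [← ofReal_norm, ENNReal.ofReal_rpow_of_nonneg (norm_nonneg _) hq.le]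
  · intro x hx
    rw [image_eq_zero_of_notMem_tsupport fun h => hx (hs h), norm_zero, Real.zero_rpow hq.ne']

theorem s9_intg {N : ℕ} (u : EuclideanSpace ℝ (Fin N) → ℝ) (hu : ContDiff ℝ (⊤ : ℕ∞) u)
    (hc : HasCompactSupport u) (Ω : Set (EuclideanSpace ℝ (Fin N))) (hs : tsupport u ⊆ Ω) (p : ℝ) (hp : 0 < p) :
    ENNReal.ofReal (∫ x in Ω, ‖gradient u x‖ ^ p) = ∫⁻ x, ‖fderiv ℝ u x‖ₑ ^ p := by
  simp_rw [s9_gradnorm]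
  exact s9_int _ (hu.continuous_fderiv (by simp)) (hc.fderiv ℝ) Ω
    ((tsupport_fderiv_subset ℝ).trans hs) p hp

theorem s9_nonneg {N : ℕ} (Ω : Set (EuclideanSpace ℝ (Fin N))) (p q : ℝ) : 0 ≤ lambdaQ Ω p q := by
  apply Real.sInf_nonneg
  rintro c ⟨u, -, -, -, -, rfl⟩
  exact integral_nonneg fun x => by positivity

theorem s9_upper {N : ℕ} (Ω : Set (EuclideanSpace ℝ (Fin N))) (u : EuclideanSpace ℝ (Fin N) → ℝ)
    (hu : ContDiff ℝ (⊤ : ℕ∞) u) (hc : HasCompactSupport u) (hs : tsupport u ⊆ Ω) (p q : ℝ) (hp : 0 < p) (hq : 0 < q)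
    (hI : 0 < ∫ x in Ω, |u x| ^ q) :
    (∃ v : EuclideanSpace ℝ (Fin N) → ℝ, ContDiff ℝ (⊤ : ℕ∞) v ∧ HasCompactSupport v ∧ tsupport v ⊆ Ω ∧
      (∫ x in Ω, |v x| ^ q) ^ (1 / q) = 1) ∧
    lambdaQ Ω p q ≤ (∫ x in Ω, ‖gradient u x‖ ^ p) * (∫ x in Ω, |u x| ^ q) ^ (-(p / q)) := by
  set I := ∫ x in Ω, |u x| ^ q with hIdef
  set k : ℝ := I ^ (-(1 / q)) with hk
  have hk0 : 0 < k := Real.rpow_pos_of_pos hI _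
  have h1 : ContDiff ℝ (⊤ : ℕ∞) (fun x => k * u x) := contDiff_const.mul hu
  have h2 : HasCompactSupport (fun x => k * u x) := hc.mul_left
  have h3 : tsupport (fun x => k * u x) ⊆ Ω := (tsupport_mul_subset_right).trans hs
  have h4 : (∫ x in Ω, |k * u x| ^ q) ^ (1 / q) = 1 := by
    have : ∀ x, |k * u x| ^ q = k ^ q * |u x| ^ q := fun x => by
      rw [abs_mul, abs_of_pos hk0, Real.mul_rpow hk0.le (abs_nonneg _)]
    simp_rw [this]
    rw [integral_const_mul, ← hIdef, hk, ← Real.rpow_mul hI.le]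
    have : -(1 / q) * q = -1 := by field_simp
    rw [this, Real.rpow_neg_one, inv_mul_cancel₀ hI.ne', Real.one_rpow]
  refine ⟨⟨_, h1, h2, h3, h4⟩, ?_⟩
  apply csInf_le
  · refine ⟨0, ?_⟩
    rintro c ⟨u, -, -, -, -, rfl⟩
    exact integral_nonneg fun x => by positivity
  · refine ⟨_, h1, h2, h3, h4, ?_⟩
    have : ∀ x, ‖gradient (fun x => k * u x) x‖ ^ p = k ^ p * ‖gradient u x‖ ^ p := fun x => by
      rw [s9_gradnorm, s9_gradnorm, fderiv_const_mul ((hu.differentiable (by simp)) x), norm_smul,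
        Real.mul_rpow (norm_nonneg _) (norm_nonneg _), Real.norm_of_nonneg hk0.le]
    simp_rw [this]
    rw [integral_const_mul, hk, ← Real.rpow_mul hI.le, mul_comm]
    congr 2
    field_simp

theorem s9_holder {N : ℕ} (Ω : Set (EuclideanSpace ℝ (Fin N))) (hΩb : Bornology.IsBounded Ω) (u : EuclideanSpace ℝ (Fin N) → ℝ)
    (hu : Continuous u) (hc : HasCompactSupport u) (q r : ℝ) (hq : 0 < q) (hqr : q ≤ r) :
    (∫ x in Ω, |u x| ^ q) ^ (1 / q) ≤ (∫ x in Ω, |u x| ^ r) ^ (1 / r) * (volume Ω).toReal ^ (1 / q - 1 / r) := by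
  have hr : 0 < r := hq.trans_le hqr
  have h := eLpNorm_le_eLpNorm_mul_rpow_measure_univ (μ := volume.restrict Ω) (f := u)
    (ENNReal.ofReal_le_ofReal hqr) hu.aestronglyMeasurable
  have hm : ∀ q : ℝ, 0 < q → eLpNorm u (ENNReal.ofReal q) (volume.restrict Ω) = ENNReal.ofReal ((∫ x in Ω, |u x| ^ q) ^ (1 / q)) := by
    intro q hq
    rw [MemLp.eLpNorm_eq_integral_rpow_norm (by simpa using hq) ENNReal.ofReal_ne_top
      (hu.memLp_of_hasCompactSupport hc), ENNReal.toReal_ofReal hq.le, one_div]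
    rfl
  rw [hm q hq, hm r hr, ENNReal.toReal_ofReal hq.le, ENNReal.toReal_ofReal hr.le, Measure.restrict_apply_univ] at h
  have hfin : volume Ω ≠ ∞ := hΩb.measure_lt_top.ne
  have hexp : 0 ≤ 1 / q - 1 / r := sub_nonneg.2 (one_div_le_one_div_of_le hq hqr)
  rw [← ENNReal.ofReal_toReal hfin, ENNReal.ofReal_rpow_of_nonneg ENNReal.toReal_nonneg hexp,
    ← ENNReal.ofReal_mul (by positivity)] at h
  exact (ENNReal.ofReal_le_ofReal_iff (by positivity)).1 h


theorem s9_testQ {N : ℕ} (hN : 2 ≤ N) (Ω : Set (EuclideanSpace ℝ (Fin N))) (hΩo : IsOpen Ω) (hΩb : Bornology.IsBounded Ω)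
    (x0 : EuclideanSpace ℝ (Fin N)) (p δ R η q : ℝ) (hp : 1 < p) (hpN : p < N) (hδ : 0 < δ) (hδR : δ < R) (hη : 1 < η)
    (hR : closedBall x0 R ⊆ Ω) (hq : 0 < q) :
    (∃ v : EuclideanSpace ℝ (Fin N) → ℝ, ContDiff ℝ (⊤ : ℕ∞) v ∧ HasCompactSupport v ∧ tsupport v ⊆ Ω ∧
      (∫ x in Ω, |v x| ^ q) ^ (1 / q) = 1) ∧
    lambdaQ Ω p q ≤ (η ^ p * (N * (volume (ball (0 : EuclideanSpace ℝ (Fin N)) 1)).toReal) *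
        ((N - p) / (p - 1)) ^ (p - 1) * (δ ^ (-((N - p) / (p - 1))) - R ^ (-((N - p) / (p - 1)))) ^ (1 - p)) *
        ((volume (ball (0 : EuclideanSpace ℝ (Fin N)) 1)).toReal * δ ^ (N : ℝ)) ^ (-(p / q)) := by
  obtain ⟨u, hu, hc, hs, h1, hG⟩ := s9_test hN x0 p δ R η hp hpN hδ hδR hη
  have hs' := hs.trans hR
  have hp0 : 0 < p := by linarith
  have : Nonempty (Fin N) := ⟨⟨0, by omega⟩⟩
  have hω : 0 < (volume (ball (0 : EuclideanSpace ℝ (Fin N)) 1)).toReal :=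
    ENNReal.toReal_pos (measure_ball_pos _ _ one_pos).ne' measure_ball_lt_top.ne
  set ω := (volume (ball (0 : EuclideanSpace ℝ (Fin N)) 1)).toReal with hωd
  have ha : 0 < (N - p) / (p - 1) := div_pos (by linarith) (by linarith)
  have hd : 0 < δ ^ (-((N - p) / (p - 1))) - R ^ (-((N - p) / (p - 1))) :=
    sub_pos.2 (Real.rpow_lt_rpow_of_neg hδ hδR (by linarith))
  have hI : ω * δ ^ (N : ℝ) ≤ ∫ x in Ω, |u x| ^ q := by
    have hball : (volume (ball x0 δ)) = ENNReal.ofReal (ω * δ ^ (N : ℝ)) := by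
      rw [Measure.addHaar_ball _ _ hδ.le, mul_comm, ENNReal.ofReal_mul hω.le, hωd,
        ENNReal.ofReal_toReal measure_ball_lt_top.ne]
      simp
    rw [← ENNReal.ofReal_le_ofReal_iff (by positivity)]
    have := s9_int u hu.continuous hc Ω hs' q hq
    simp only [Real.norm_eq_abs] at this
    rw [this, ← hball]
    calc volume (ball x0 δ) = ∫⁻ x in ball x0 δ, 1 := by simp
      _ ≤ ∫⁻ x in ball x0 δ, ‖u x‖ₑ ^ q := by
        apply setLIntegral_mono' measurableSet_ball
        intro x hx
        rw [h1 x hx]; simp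
      _ ≤ _ := setLIntegral_le_lintegral _ _
  have hpos : 0 < ω * δ ^ (N : ℝ) := by positivity
  obtain ⟨h2, h3⟩ := s9_upper Ω u hu hc hs' p q hp0 hq (hpos.trans_le hI)
  refine ⟨h2, h3.trans ?_⟩
  have hG' : (∫ x in Ω, ‖gradient u x‖ ^ p) ≤ η ^ p * (N * ω) *
        ((N - p) / (p - 1)) ^ (p - 1) * (δ ^ (-((N - p) / (p - 1))) - R ^ (-((N - p) / (p - 1)))) ^ (1 - p) := by
    rw [← s9_intg u hu hc Ω hs' p hp0] at hG
    refine (ENNReal.ofReal_le_ofReal_iff ?_).1 hG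
    have := Real.rpow_pos_of_pos hd (1 - p)
    positivity
  refine mul_le_mul hG' ?_ (Real.rpow_nonneg (hpos.le.trans hI) _) ((integral_nonneg fun x => by positivity).trans hG')
  exact Real.rpow_le_rpow_of_nonpos hpos hI (by have := div_pos hp0 hq; linarith)

theorem s9_anti {N : ℕ} (Ω : Set (EuclideanSpace ℝ (Fin N))) (hΩb : Bornology.IsBounded Ω) (hV : 0 < (volume Ω).toReal)
    (p : ℝ) (hp : 1 < p) (hne : ∀ q : ℝ, 0 < q → (∃ v : EuclideanSpace ℝ (Fin N) → ℝ, ContDiff ℝ (⊤ : ℕ∞) v ∧ HasCompactSupport v ∧ tsupport v ⊆ Ω ∧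
      (∫ x in Ω, |v x| ^ q) ^ (1 / q) = 1)) (q r : ℝ) (hq : 0 < q) (hqr : q ≤ r) :
    lambdaQ Ω p r * (volume Ω).toReal ^ (p / r) ≤ lambdaQ Ω p q * (volume Ω).toReal ^ (p / q) := by
  set V := (volume Ω).toReal with hVd
  have hr : 0 < r := hq.trans_le hqr
  have key : lambdaQ Ω p r * V ^ (p / r) * V ^ (-(p / q)) ≤ lambdaQ Ω p q := by
    apply le_csInf
    · obtain ⟨v, h1, h2, h3, h4⟩ := hne q hq
      exact ⟨_, v, h1, h2, h3, h4, rfl⟩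
    rintro c ⟨u, h1, h2, h3, h4, rfl⟩
    have hh := s9_holder Ω hΩb u h1.continuous h2 q r hq hqr
    rw [h4, ← hVd] at hh
    have hI0 : 0 ≤ ∫ x in Ω, |u x| ^ r := integral_nonneg fun x => by positivity
    have hI : 0 < ∫ x in Ω, |u x| ^ r := by
      rcases hI0.lt_or_eq with h | h
      · exact h
      · rw [← h, Real.zero_rpow (by positivity)] at hh
        linarith
    obtain ⟨-, h5⟩ := s9_upper Ω u h1 h2 h3 p r (by linarith) hr hI
    have hG0 : 0 ≤ ∫ x in Ω, ‖gradient u x‖ ^ p := integral_nonneg fun x => by positivity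
    set I := ∫ x in Ω, |u x| ^ r
    set G := ∫ x in Ω, ‖gradient u x‖ ^ p
    have h6 : 1 ≤ I ^ (p / r) * V ^ (p / q - p / r) := by
      have := Real.one_le_rpow hh (by linarith : 0 ≤ p)
      rw [Real.mul_rpow (by positivity) (by positivity), ← Real.rpow_mul hI.le, ← Real.rpow_mul hV.le] at this
      convert this using 3 <;> ring
    calc lambdaQ Ω p r * V ^ (p / r) * V ^ (-(p / q))
        ≤ G * I ^ (-(p / r)) * V ^ (p / r) * V ^ (-(p / q)) := by gcongr
      _ ≤ G * I ^ (-(p / r)) * V ^ (p / r) * V ^ (-(p / q)) * (I ^ (p / r) * V ^ (p / q - p / r)) :=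
        le_mul_of_one_le_right (by positivity) h6
      _ = G * (I ^ (-(p / r)) * I ^ (p / r)) * (V ^ (p / r) * V ^ (-(p / q)) * V ^ (p / q - p / r)) := by ring
      _ = G := by
        rw [← Real.rpow_add hI, ← Real.rpow_add hV, ← Real.rpow_add hV]
        rw [show p / r + -(p / q) + (p / q - p / r) = 0 by ring]
        simp
  calc lambdaQ Ω p r * V ^ (p / r) = lambdaQ Ω p r * V ^ (p / r) * V ^ (-(p / q)) * V ^ (p / q) := by
        rw [mul_assoc _ (V ^ (-(p / q))), ← Real.rpow_add hV]; simp
    _ ≤ _ := by gcongr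

theorem s9_lower {N : ℕ} (hN : 2 ≤ N) (Ω : Set (EuclideanSpace ℝ (Fin N))) (hΩb : Bornology.IsBounded Ω) (hV : 0 < (volume Ω).toReal)
    (p : ℝ) (hp : 1 < p) (hpN : p < N) (hne : ∀ q : ℝ, 0 < q → (∃ v : EuclideanSpace ℝ (Fin N) → ℝ, ContDiff ℝ (⊤ : ℕ∞) v ∧ HasCompactSupport v ∧ tsupport v ⊆ Ω ∧
      (∫ x in Ω, |v x| ^ q) ^ (1 / q) = 1)) (q ω B D : ℝ) (hq : 0 < q) (hqr : q ≤ N * p / (N - p))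
    (hω : ω = (volume (ball (0 : EuclideanSpace ℝ (Fin N)) 1)).toReal)
    (hB : B = ((N * ω * ((p - 1) / (N - p))) ^ ((p - 1) / p) + 2 ^ (N + 1) * ω) / (N * ω))
    (hD : D = p * 5 ^ N * 2 ^ p / (p - 1)) :
    (B * D ^ ((N - p) / (N * p)) * (volume Ω).toReal ^ (1 / q - (N - p) / (N * p))) ^ (-p) ≤ lambdaQ Ω p q := by
  set V := (volume Ω).toReal with hVd
  have : Nonempty (Fin N) := ⟨⟨0, by omega⟩⟩
  have hω0 : 0 < ω := hω ▸
    ENNReal.toReal_pos (measure_ball_pos _ _ one_pos).ne' measure_ball_lt_top.ne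
  have hp0 : 0 < p := by linarith
  have hN0 : (0 : ℝ) < N := by linarith
  have hNp : 0 < N - p := by linarith
  have hp1 : 0 < p - 1 := by linarith
  have hB0 : 0 < B := by rw [hB]; positivity
  have hD0 : 0 < D := by rw [hD]; positivity
  apply le_csInf
  · obtain ⟨v, h1, h2, h3, h4⟩ := hne q hq
    exact ⟨_, v, h1, h2, h3, h4, rfl⟩
  rintro c ⟨u, h1, h2, h3, h4, rfl⟩
  have hh := s9_holder Ω hΩb u h1.continuous h2 q _ hq hqr
  rw [h4, ← hVd] at hh
  have hS := s9_sobolev hN u (h1.of_le (by exact_mod_cast le_top)) h2 p hp hpN ω hω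
  rw [← hB, ← hD, ← s9_intg u h1 h2 Ω h3 p hp0, ← s9_int u h1.continuous h2 Ω h3 _ (by positivity)] at hS
  have hG0 : 0 ≤ ∫ x in Ω, ‖gradient u x‖ ^ p := integral_nonneg fun x => by positivity
  set G := ∫ x in Ω, ‖gradient u x‖ ^ p
  simp only [Real.norm_eq_abs] at hS
  have hI0 : 0 ≤ ∫ x in Ω, |u x| ^ (N * p / (N - p)) := integral_nonneg fun x => by positivity
  set I := ∫ x in Ω, |u x| ^ (N * p / (N - p))
  rw [ENNReal.ofReal_rpow_of_nonneg hB0.le (by positivity), ENNReal.ofReal_rpow_of_nonneg hG0 (by positivity),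
    ← ENNReal.ofReal_mul (by positivity), ← ENNReal.ofReal_mul (by positivity),
    ENNReal.ofReal_le_ofReal_iff (by positivity)] at hS
  have e1 : (1 : ℝ) / (N * p / (N - p)) = (N - p) / (N * p) := by rw [one_div, inv_div]
  rw [e1] at hh
  have h5 : I ^ ((N - p) / (N * p)) ≤ B * D ^ ((N - p) / (N * p)) * G ^ (1 / p) := by
    calc _ ≤ (B ^ (N * p / (N - p)) * D * G ^ (N / (N - p))) ^ ((N - p) / (N * p)) :=
          Real.rpow_le_rpow hI0 hS (by positivity)
      _ = _ := by
        rw [Real.mul_rpow (by positivity) (by positivity), Real.mul_rpow (by positivity) (by positivity),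
          ← Real.rpow_mul hB0.le, ← Real.rpow_mul hG0]
        have e2 : N * p / (N - p) * ((N - p) / (N * p)) = 1 := by field_simp
        have e3 : N / (N - p) * ((N - p) / (N * p)) = 1 / p := by field_simp
        rw [e2, e3, Real.rpow_one]
  set c := B * D ^ ((N - p) / (N * p)) * V ^ (1 / q - (N - p) / (N * p)) with hc
  have hc0 : 0 < c := by positivity
  have h6 : 1 ≤ c * G ^ (1 / p) := by
    calc (1 : ℝ) ≤ _ := hh
      _ ≤ (B * D ^ ((N - p) / (N * p)) * G ^ (1 / p)) * V ^ (1 / q - (N - p) / (N * p)) := by gcongr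
      _ = _ := by rw [hc]; ring
  have h7 := Real.one_le_rpow h6 hp0.le
  rw [Real.mul_rpow hc0.le (by positivity), ← Real.rpow_mul hG0, one_div_mul_cancel hp0.ne', Real.rpow_one] at h7
  rw [Real.rpow_neg hc0.le, inv_le_iff_one_le_mul₀ (by positivity)]
  linarith


theorem s9_upalg (N p ω R τ : ℝ) (hp : 1 < p) (hpN : p < N) (hω : 0 < ω) (hR : 0 < R) (hτ : 0 < τ) (hτ1 : τ < 1) :
    ((1 + τ) ^ p * (N * ω) * ((N - p) / (p - 1)) ^ (p - 1) *
      ((R * τ ^ ((p - 1) / (N - p))) ^ (-((N - p) / (p - 1))) - R ^ (-((N - p) / (p - 1)))) ^ (1 - p)) *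
      (ω * (R * τ ^ ((p - 1) / (N - p))) ^ N) ^ (-((N - p) / N)) =
    (1 + τ) ^ p * (1 - τ) ^ (1 - p) * (N * ω * ((N - p) / (p - 1)) ^ (p - 1) * ω ^ (-((N - p) / N))) := by
  have hNp : 0 < N - p := by linarith
  have hp1 : 0 < p - 1 := by linarith
  have hN0 : 0 < N := by linarith
  set δ := R * τ ^ ((p - 1) / (N - p)) with hδ
  have hδ0 : 0 < δ := by positivity
  have e1 : R ^ (-((N - p) / (p - 1))) = δ ^ (-((N - p) / (p - 1))) * τ := by
    rw [hδ, Real.mul_rpow hR.le (by positivity), ← Real.rpow_mul hτ.le]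
    rw [show (p - 1) / (N - p) * -((N - p) / (p - 1)) = -1 by field_simp, Real.rpow_neg_one]
    field_simp
  have e2 : δ ^ (-((N - p) / (p - 1))) - R ^ (-((N - p) / (p - 1))) = δ ^ (-((N - p) / (p - 1))) * (1 - τ) := by
    rw [e1]; ring
  have h1τ : 0 < 1 - τ := by linarith
  rw [e2, Real.mul_rpow (by positivity) h1τ.le, Real.mul_rpow hω.le (by positivity), ← Real.rpow_mul hδ0.le,
    ← Real.rpow_mul hδ0.le]
  rw [show -((N - p) / (p - 1)) * (1 - p) = N - p by field_simp; ring, show N * -((N - p) / N) = -(N - p) by field_simp]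
  have e3 : δ ^ (N - p) * δ ^ (-(N - p)) = 1 := by rw [← Real.rpow_add hδ0]; simp
  linear_combination ((1 + τ) ^ p * (N * ω) * ((N - p) / (p - 1)) ^ (p - 1) * (1 - τ) ^ (1 - p) * ω ^ (-((N - p) / N))) * e3


theorem s9_Ulim (N ω : ℝ) (hN : 2 ≤ N) (hω : 0 < ω) :
    Tendsto (fun p => (N * ω * ((N - p) / (p - 1)) ^ (p - 1) * ω ^ (-((N - p) / N))) / (N - p) ^ (p - 1)) (𝓝[<] N)
      (𝓝 (N * ω / (N - 1) ^ (N - 1))) := by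
  have h1 : Tendsto (fun p => N * ω / (p - 1) ^ (p - 1) * ω ^ (-((N - p) / N))) (𝓝 N)
      (𝓝 (N * ω / (N - 1) ^ (N - 1) * ω ^ (-((N - N) / N)))) := by
    apply ContinuousAt.tendsto (f := fun p : ℝ => N * ω / (p - 1) ^ (p - 1) * ω ^ (-((N - p) / N)))
    have : N - 1 ≠ 0 := by linarith
    have : N - 1 > 0 := by linarith
    have h3 : (N - 1) ^ (N - 1) ≠ 0 := (Real.rpow_pos_of_pos this _).ne'
    refine ContinuousAt.mul (ContinuousAt.div continuousAt_const (ContinuousAt.rpow (by fun_prop) (by fun_prop) (Or.inl (by assumption))) h3)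
      (ContinuousAt.rpow (by fun_prop) (by fun_prop) (Or.inl hω.ne'))
  simp only [sub_self, zero_div, neg_zero, Real.rpow_zero, mul_one] at h1
  refine (h1.mono_left nhdsWithin_le_nhds).congr' ?_
  filter_upwards [Ioo_mem_nhdsLT (show (1 : ℝ) < N by linarith)] with p hp
  have hNp : 0 < N - p := by linarith [hp.2]
  have hp1 : 0 < p - 1 := by linarith [hp.1]
  rw [Real.div_rpow hNp.le hp1.le]
  field_simp

theorem s9_Llim (N ω C : ℝ) (hN : 2 ≤ N) (hω : 0 < ω) (hC : 0 < C) (M : ℝ) (hM : 0 < M) :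
    Tendsto (fun p => ((((N * ω * ((p - 1) / (N - p))) ^ ((p - 1) / p) + C * ω) / (N * ω)) *
      (p * M * 2 ^ p / (p - 1)) ^ ((N - p) / (N * p))) ^ (-p) / (N - p) ^ (p - 1)) (𝓝[<] N)
      (𝓝 (N * ω / (N - 1) ^ (N - 1))) := by
  have hN0 : 0 < N := by linarith
  have hN1 : 0 < N - 1 := by linarith
  have h1 : Tendsto (fun p => ((((N * ω * (p - 1)) ^ ((p - 1) / p) + C * ω * (N - p) ^ ((p - 1) / p)) / (N * ω)) *
      (p * M * 2 ^ p / (p - 1)) ^ ((N - p) / (N * p))) ^ (-p)) (𝓝 N)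
      (𝓝 (((((N * ω * (N - 1)) ^ ((N - 1) / N) + C * ω * (N - N) ^ ((N - 1) / N)) / (N * ω)) *
      (N * M * 2 ^ N / (N - 1)) ^ ((N - N) / (N * N))) ^ (-N))) := by
    apply ContinuousAt.tendsto (f := fun p : ℝ => ((((N * ω * (p - 1)) ^ ((p - 1) / p) + C * ω * (N - p) ^ ((p - 1) / p)) / (N * ω)) *
      (p * M * 2 ^ p / (p - 1)) ^ ((N - p) / (N * p))) ^ (-p))
    have cexp : ContinuousAt (fun p : ℝ => (p - 1) / p) N :=
      ContinuousAt.div (by fun_prop) (by fun_prop) hN0.ne'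
    have c1 : ContinuousAt (fun p : ℝ => (N * ω * (p - 1)) ^ ((p - 1) / p)) N :=
      ContinuousAt.rpow (by fun_prop) cexp (Or.inl (by positivity))
    have c2 : ContinuousAt (fun p : ℝ => (N - p) ^ ((p - 1) / p)) N :=
      ContinuousAt.rpow (by fun_prop) cexp (Or.inr (by positivity))
    have c3 : ContinuousAt (fun p : ℝ => p * M * 2 ^ p / (p - 1)) N := by
      refine ContinuousAt.div (ContinuousAt.mul (by fun_prop) ?_) (by fun_prop) hN1.ne'
      exact ContinuousAt.rpow (by fun_prop) (by fun_prop) (Or.inl (by norm_num))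
    have c4 : ContinuousAt (fun p : ℝ => (p * M * 2 ^ p / (p - 1)) ^ ((N - p) / (N * p))) N :=
      ContinuousAt.rpow c3 (ContinuousAt.div (by fun_prop) (by fun_prop) (by positivity)) (Or.inl (by positivity))
    refine ContinuousAt.rpow ((((c1.add (continuousAt_const.mul c2)).div_const _)).mul c4) (by fun_prop) (Or.inl ?_)
    simp only [sub_self]
    positivity
  have hv : ((((N * ω * (N - 1)) ^ ((N - 1) / N) + C * ω * (N - N) ^ ((N - 1) / N)) / (N * ω)) *
      (N * M * 2 ^ N / (N - 1)) ^ ((N - N) / (N * N))) ^ (-N) = N * ω / (N - 1) ^ (N - 1) := by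
    have hA : 0 < N * ω := by positivity
    rw [sub_self, zero_div, Real.rpow_zero, Real.zero_rpow (by positivity), mul_zero, add_zero, mul_one,
      Real.div_rpow (by positivity) hA.le, ← Real.rpow_mul (by positivity),
      show (N - 1) / N * -N = -(N - 1) by field_simp, Real.mul_rpow hA.le hN1.le,
      Real.rpow_neg hN1.le, Real.rpow_neg hA.le N, Real.rpow_neg hA.le (N - 1), Real.rpow_sub_one hA.ne']
    have : (N * ω) ^ N ≠ 0 := by positivity
    have : (N - 1) ^ (N - 1) ≠ 0 := by positivity
    generalize (N * ω) ^ N = x at *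
    generalize (N - 1) ^ (N - 1) = y at *
    field_simp
  rw [hv] at h1
  refine (h1.mono_left nhdsWithin_le_nhds).congr' ?_
  filter_upwards [Ioo_mem_nhdsLT (show (1 : ℝ) < N by linarith)] with p hp
  have hNp : 0 < N - p := by linarith [hp.2]
  have hp1 : 0 < p - 1 := by linarith [hp.1]
  have hp0 : 0 < p := by linarith
  have hA : 0 < N * ω := by positivity
  have e : ((N * ω * (p - 1)) ^ ((p - 1) / p) + C * ω * (N - p) ^ ((p - 1) / p)) / (N * ω) =
      ((N * ω * ((p - 1) / (N - p))) ^ ((p - 1) / p) + C * ω) / (N * ω) * (N - p) ^ ((p - 1) / p) := by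
    rw [show N * ω * ((p - 1) / (N - p)) = (N * ω * (p - 1)) / (N - p) by ring, Real.div_rpow (by positivity) hNp.le]
    have : (N - p) ^ ((p - 1) / p) ≠ 0 := by positivity
    field_simp
  rw [e]
  have e' : ((N - p) ^ ((p - 1) / p)) ^ (-p) = 1 / (N - p) ^ (p - 1) := by
    rw [← Real.rpow_mul hNp.le, show (p - 1) / p * -p = -(p - 1) by field_simp, Real.rpow_neg hNp.le, one_div]
  rw [mul_right_comm, Real.mul_rpow (by positivity) (by positivity), e']
  ring

theorem s9_final {N : ℕ} (hN : 2 ≤ N) (Ω : Set (EuclideanSpace ℝ (Fin N)))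
    (hΩo : IsOpen Ω) (hΩb : Bornology.IsBounded Ω) (hΩne : Ω.Nonempty) :
    ∃ Λ : ℝ → ℝ,
      (∀ p : ℝ, 1 < p → p < N →
        Tendsto (fun q => lambdaQ Ω p q) (𝓝[<] (N * p / (N - p))) (𝓝 (Λ p))) ∧
      Tendsto (fun p => Λ p / ((N : ℝ) - p) ^ (p - 1)) (𝓝[<] (N : ℝ))
        (𝓝 (N * (volume (ball (0 : EuclideanSpace ℝ (Fin N)) 1)).toReal /
          ((N : ℝ) - 1) ^ ((N : ℝ) - 1))) := by
  have hN2 : (2 : ℝ) ≤ N := by exact_mod_cast hN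
  have hN0 : (0 : ℝ) < N := by linarith
  have hfin : volume Ω ≠ ∞ := hΩb.measure_lt_top.ne
  have hV : 0 < (volume Ω).toReal := ENNReal.toReal_pos (hΩo.measure_pos _ hΩne).ne' hfin
  obtain ⟨x0, hx0⟩ := hΩne
  obtain ⟨R, hR, hRΩ⟩ := Metric.nhds_basis_closedBall.mem_iff.1 (hΩo.mem_nhds hx0)
  have hω : 0 < (volume (ball (0 : EuclideanSpace ℝ (Fin N)) 1)).toReal :=
    ENNReal.toReal_pos (measure_ball_pos _ _ one_pos).ne' measure_ball_lt_top.ne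
  have hne : ∀ q : ℝ, 0 < q → (∃ v : EuclideanSpace ℝ (Fin N) → ℝ, ContDiff ℝ (⊤ : ℕ∞) v ∧ HasCompactSupport v ∧ tsupport v ⊆ Ω ∧
      (∫ x in Ω, |v x| ^ q) ^ (1 / q) = 1) := fun q hq =>
    (s9_testQ hN Ω hΩo hΩb x0 (3 / 2) (R / 2) R 2 q (by norm_num) (by linarith) (by positivity) (by linarith) (by norm_num) hRΩ hq).1
  set ω := (volume (ball (0 : EuclideanSpace ℝ (Fin N)) 1)).toReal with hωd
  have hs : ∀ p : ℝ, 1 < p → p < N → 1 < N * p / (N - p) := by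
    intro p hp hpN
    rw [lt_div_iff₀ (by linarith)]
    nlinarith
  have hlim : ∀ p : ℝ, ∃ l : ℝ, 1 < p → p < N →
      Tendsto (fun q => lambdaQ Ω p q) (𝓝[<] (N * p / (N - p))) (𝓝 l) := by
    intro p
    by_cases h : 1 < p ∧ p < N
    swap
    · exact ⟨0, fun h1 h2 => (h ⟨h1, h2⟩).elim⟩
    obtain ⟨hp, hpN⟩ := h
    have hs1 := hs p hp hpN
    have := AntitoneOn.tendsto_nhdsWithin_Ioo_left (f := fun q => lambdaQ Ω p q * (volume Ω).toReal ^ (p / q))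
      (Set.nonempty_Ioo.2 hs1) (fun q hq r hr hqr => s9_anti Ω hΩb hV p hp hne q r (by linarith [hq.1]) hqr)
      ⟨0, by
        rintro _ ⟨q, -, rfl⟩
        exact mul_nonneg (s9_nonneg _ _ _) (by positivity)⟩
    have h2 : Tendsto (fun q => (volume Ω).toReal ^ (-(p / q))) (𝓝[<] (N * p / (N - p))) (𝓝 ((volume Ω).toReal ^ (-(p / (N * p / (N - p)))))) := by
      apply Tendsto.mono_left _ nhdsWithin_le_nhds
      apply ContinuousAt.tendsto (f := fun q => (volume Ω).toReal ^ (-(p / q)))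
      exact ContinuousAt.rpow (by fun_prop) (ContinuousAt.neg (ContinuousAt.div (by fun_prop) (by fun_prop) (by linarith))) (Or.inl hV.ne')
    refine ⟨_, fun _ _ => (this.mul h2).congr fun q => ?_⟩
    rw [mul_assoc, ← Real.rpow_add hV]
    simp
  choose Λ hΛ using hlim
  refine ⟨Λ, hΛ, ?_⟩
  have hup : ∀ p : ℝ, 1 < p → p < N → Λ p ≤ N * ω * ((N - p) / (p - 1)) ^ (p - 1) * ω ^ (-((N - p) / N)) := by
    intro p hp hpN
    have hNp : 0 < N - p := by linarith
    have hp1 : 0 < p - 1 := by linarith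
    have hs1 := hs p hp hpN
    have key : ∀ τ : ℝ, 0 < τ → τ < 1 → Λ p ≤ (1 + τ) ^ p * (1 - τ) ^ (1 - p) * (N * ω * ((N - p) / (p - 1)) ^ (p - 1) * ω ^ (-((N - p) / N))) := by
      intro τ hτ hτ1
      rw [← s9_upalg N p ω R τ hp hpN hω hR hτ hτ1]
      have hδ0 : 0 < R * τ ^ ((p - 1) / (N - p)) := by positivity
      have hδR : R * τ ^ ((p - 1) / (N - p)) < R := by
        have := Real.rpow_lt_one hτ.le hτ1 (div_pos hp1 hNp)
        nlinarith
      have h2 : Tendsto (fun q : ℝ => (ω * (R * τ ^ ((p - 1) / (N - p))) ^ (N : ℝ)) ^ (-(p / q))) (𝓝[<] (N * p / (N - p)))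
          (𝓝 ((ω * (R * τ ^ ((p - 1) / (N - p))) ^ (N : ℝ)) ^ (-(p / (N * p / (N - p)))))) := by
        apply Tendsto.mono_left _ nhdsWithin_le_nhds
        apply ContinuousAt.tendsto (f := fun q : ℝ => (ω * (R * τ ^ ((p - 1) / (N - p))) ^ (N : ℝ)) ^ (-(p / q)))
        exact ContinuousAt.rpow (by fun_prop) (ContinuousAt.neg (ContinuousAt.div (by fun_prop) (by fun_prop) (by linarith))) (Or.inl (by positivity))
      rw [show p / (N * p / (N - p)) = (N - p) / N by field_simp] at h2
      refine le_of_tendsto_of_tendsto (hΛ p hp hpN) (h2.const_mul _) ?_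
      filter_upwards [Ioo_mem_nhdsLT hs1] with q hq
      exact (s9_testQ hN Ω hΩo hΩb x0 p _ R (1 + τ) q hp hpN hδ0 hδR (by linarith) hRΩ (by linarith [hq.1])).2
    have hc : Tendsto (fun τ : ℝ => (1 + τ) ^ p * (1 - τ) ^ (1 - p) * (N * ω * ((N - p) / (p - 1)) ^ (p - 1) * ω ^ (-((N - p) / N)))) (𝓝[>] 0)
        (𝓝 ((1 + 0) ^ p * (1 - 0) ^ (1 - p) * (N * ω * ((N - p) / (p - 1)) ^ (p - 1) * ω ^ (-((N - p) / N))))) := by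
      apply Tendsto.mono_left _ nhdsWithin_le_nhds
      apply Tendsto.mul_const
      apply ContinuousAt.tendsto (f := fun τ : ℝ => (1 + τ) ^ p * (1 - τ) ^ (1 - p))
      exact ContinuousAt.mul (ContinuousAt.rpow (by fun_prop) (by fun_prop) (Or.inl (by norm_num)))
        (ContinuousAt.rpow (by fun_prop) (by fun_prop) (Or.inl (by norm_num)))
    simp only [add_zero, sub_zero, Real.one_rpow, one_mul] at hc
    refine ge_of_tendsto hc ?_
    filter_upwards [Ioo_mem_nhdsGT (zero_lt_one (α := ℝ))] with τ hτ using key τ hτ.1 hτ.2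
  have hlo : ∀ p : ℝ, 1 < p → p < N → ((((N * ω * ((p - 1) / (N - p))) ^ ((p - 1) / p) + 2 ^ (N + 1) * ω) / (N * ω)) *
      (p * 5 ^ N * 2 ^ p / (p - 1)) ^ ((N - p) / (N * p))) ^ (-p) ≤ Λ p := by
    intro p hp hpN
    have hNp : 0 < N - p := by linarith
    have hp1 : 0 < p - 1 := by linarith
    have hp0 : 0 < p := by linarith
    have hs1 := hs p hp hpN
    set A := (((N * ω * ((p - 1) / (N - p))) ^ ((p - 1) / p) + 2 ^ (N + 1) * ω) / (N * ω)) *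
      (p * 5 ^ N * 2 ^ p / (p - 1)) ^ ((N - p) / (N * p)) with hA
    have hA0 : 0 < A := by positivity
    have h2 : Tendsto (fun q : ℝ => (A * (volume Ω).toReal ^ (1 / q - (N - p) / (N * p))) ^ (-p)) (𝓝[<] (N * p / (N - p)))
          (𝓝 ((A * (volume Ω).toReal ^ (1 / (N * p / (N - p)) - (N - p) / (N * p))) ^ (-p))) := by
      apply Tendsto.mono_left _ nhdsWithin_le_nhds
      apply ContinuousAt.tendsto (f := fun q : ℝ => (A * (volume Ω).toReal ^ (1 / q - (N - p) / (N * p))) ^ (-p))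
      refine ContinuousAt.rpow (ContinuousAt.mul (by fun_prop) ?_) (by fun_prop) (Or.inl (by positivity))
      exact ContinuousAt.rpow (by fun_prop) (ContinuousAt.sub (ContinuousAt.div (by fun_prop) (by fun_prop) (by linarith)) (by fun_prop)) (Or.inl hV.ne')
    rw [show 1 / (N * p / (N - p)) - (N - p) / (N * p) = 0 by rw [one_div, inv_div, sub_self], Real.rpow_zero, mul_one] at h2
    refine le_of_tendsto_of_tendsto h2 (hΛ p hp hpN) ?_
    filter_upwards [Ioo_mem_nhdsLT hs1] with q hq
    exact s9_lower hN Ω hΩb hV p hp hpN hne q ω _ _ (by linarith [hq.1]) hq.2.le hωd rfl rfl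
  refine tendsto_of_tendsto_of_tendsto_of_le_of_le' (s9_Llim N ω (2 ^ (N + 1)) hN2 hω (by positivity) (5 ^ N) (by positivity))
    (s9_Ulim N ω hN2 hω) ?_ ?_
  · filter_upwards [Ioo_mem_nhdsLT (show (1 : ℝ) < N by linarith)] with p hp
    have : (0 : ℝ) < N - p := by linarith [hp.2]
    exact div_le_div_of_nonneg_right (hlo p hp.1 hp.2) (by positivity)
  · filter_upwards [Ioo_mem_nhdsLT (show (1 : ℝ) < N by linarith)] with p hp
    have : (0 : ℝ) < N - p := by linarith [hp.2]
    exact div_le_div_of_nonneg_right (hup p hp.1 hp.2) (by positivity)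

theorem stmt9 {N : ℕ} (hN : 2 ≤ N) (Ω : Set (EuclideanSpace ℝ (Fin N)))
    (hΩo : IsOpen Ω) (hΩb : Bornology.IsBounded Ω) (hΩne : Ω.Nonempty) :
    ∃ Λ : ℝ → ℝ,
      (∀ p : ℝ, 1 < p → p < N →
        Tendsto (fun q => lambdaQ Ω p q) (𝓝[<] (N * p / (N - p))) (𝓝 (Λ p))) ∧
      Tendsto (fun p => Λ p / ((N : ℝ) - p) ^ (p - 1)) (𝓝[<] (N : ℝ))
        (𝓝 (N * (volume (ball (0 : EuclideanSpace ℝ (Fin N)) 1)).toReal /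
          ((N : ℝ) - 1) ^ ((N : ℝ) - 1))) := by
  exact s9_final hN Ω hΩo hΩb hΩne
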